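/- arXiv:1507.05548 — 3 statements merged into one kernel-verified Lean document; each statement's English description precedes it below -/
import Mathlib

section
/- For any finite subset A of 𝔽_p with |A| ≤ √p, one has max(|A·A|, |(A+1)·(A+1)|) ≫ |A|^{1 + 1/26}. -/
open Pointwise

namespace MPS

open Polynomial in
/-- Substituting polynomials of degree at most one does not raise the degree. -/
lemma natDegree_aeval_le {σ F S : Type*} [Field F] [CommRing S] [Algebra F S]
    (g : MvPolynomial σ F) (v : σ → S[X]) (hv : ∀ i, (v i).natDegree ≤ 1) :
    (MvPolynomial.aeval v g).natDegree ≤ g.totalDegree := by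
  rw [MvPolynomial.aeval_def, MvPolynomial.eval₂]
  apply (Polynomial.natDegree_sum_le _ _).trans
  apply Finset.sup_le
  intro d hd
  simp only [Function.comp_apply]
  rw [Polynomial.algebraMap_apply]
  apply (Polynomial.natDegree_C_mul_le _ _).trans
  apply (Polynomial.natDegree_prod_le _ _).trans
  have h2 : ∑ i ∈ d.support, d i ≤ g.totalDegree := by
    rw [MvPolynomial.totalDegree]
    exact Finset.le_sup_of_le hd le_rfl
  refine (Finset.sum_le_sum ?_).trans h2
  intro i _
  refine (Polynomial.natDegree_pow_le).trans ?_
  calc d i * (v i).natDegree ≤ d i * 1 := Nat.mul_le_mul_left _ (hv i)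
    _ = d i := mul_one _

open Polynomial in
lemma chain_rule {F S : Type*} [Field F] [CommRing S] [Algebra F S]
    (g : MvPolynomial (Fin 3) F) (v : Fin 3 → S[X]) :
    derivative (MvPolynomial.aeval v g)
      = ∑ i, MvPolynomial.aeval v (MvPolynomial.pderiv i g) * derivative (v i) := by
  induction g using MvPolynomial.induction_on with
  | C a =>
    simp only [MvPolynomial.aeval_C, MvPolynomial.pderiv_C, map_zero, zero_mul,
      Finset.sum_const_zero, Polynomial.algebraMap_apply, derivative_C]
  | add p q hp hq => simp only [map_add, hp, hq, add_mul, Finset.sum_add_distrib]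
  | mul_X p i hp =>
    rw [map_mul, derivative_mul, hp, MvPolynomial.aeval_X]
    fin_cases i <;>
    · simp [Fin.sum_univ_three, MvPolynomial.pderiv_mul, Pi.single_apply,
        MvPolynomial.pderiv_X]
      ring

lemma pderiv_swap {σ F : Type*} [Field F] (i j : σ) (g : MvPolynomial σ F) :
    MvPolynomial.pderiv i (MvPolynomial.pderiv j g)
      = MvPolynomial.pderiv j (MvPolynomial.pderiv i g) := by
  classical
  by_cases hij : i = j
  · rw [hij]
  ext m
  simp only [MvPolynomial.coeff_pderiv, add_right_comm, Finsupp.add_apply]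
  simp [Finsupp.single_apply, hij, Ne.symm hij]
  ring

lemma totalDegree_pderiv_succ_le {σ F : Type*} [Field F] (i : σ) (g : MvPolynomial σ F)
    (h : MvPolynomial.pderiv i g ≠ 0) :
    (MvPolynomial.pderiv i g).totalDegree + 1 ≤ g.totalDegree := by
  classical
  obtain ⟨m, hm, hmax⟩ := Finset.exists_mem_eq_sup (MvPolynomial.pderiv i g).support
    (MvPolynomial.support_nonempty.2 h) (fun s => s.sum fun _ e => e)
  rw [MvPolynomial.totalDegree, hmax]
  rw [MvPolynomial.mem_support_iff, MvPolynomial.coeff_pderiv] at hm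
  have h1 : m + Finsupp.single i 1 ∈ g.support :=
    MvPolynomial.mem_support_iff.2 (left_ne_zero_of_mul hm)
  have h2 := MvPolynomial.le_totalDegree h1
  rw [Finsupp.sum_add_index' (by simp) (by simp), Finsupp.sum_single_index rfl] at h2
  exact h2

lemma totalDegree_pderiv_le {σ F : Type*} [Field F] (i : σ) (g : MvPolynomial σ F) :
    (MvPolynomial.pderiv i g).totalDegree ≤ g.totalDegree := by
  by_cases h : MvPolynomial.pderiv i g = 0
  · simp [h]
  · have := totalDegree_pderiv_succ_le i g h; omega

lemma degreeOf_eq_zero_of_pderiv {F : Type*} [Field F] (p : ℕ) [CharP F p]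
    (g : MvPolynomial (Fin 3) F) (hd : g.totalDegree < p)
    (h : MvPolynomial.pderiv 0 g = 0) : MvPolynomial.degreeOf 0 g = 0 := by
  classical
  rw [← Nat.le_zero, MvPolynomial.degreeOf_le_iff]
  intro m hm
  by_contra hlt
  have h1 : 1 ≤ m 0 := by omega
  have hle : Finsupp.single (0 : Fin 3) 1 ≤ m := by simpa using h1
  have h2 := MvPolynomial.coeff_pderiv (i := 0) g (m - Finsupp.single 0 1)
  rw [h, tsub_add_cancel_of_le hle] at h2
  simp only [MvPolynomial.coeff_zero, Finsupp.tsub_apply, Finsupp.single_eq_same] at h2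
  have h3 := mul_eq_zero.1 h2.symm
  rcases h3 with h3 | h3
  · exact (MvPolynomial.mem_support_iff.1 hm) h3
  · have h4 : ((m 0 : ℕ) : F) = 0 := by
      rw [← h3]; push_cast [Nat.cast_sub h1]; ring
    rw [CharP.cast_eq_zero_iff F p] at h4
    have h5 := Nat.le_of_dvd h1 h4
    have h6 := MvPolynomial.le_totalDegree hm
    have h7 : m 0 ≤ m.sum fun _ e => e := by
      rw [Finsupp.sum_fintype _ _ (by simp)]
      exact Finset.single_le_sum (f := fun i => m i) (by simp) (Finset.mem_univ 0)
    omega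

/-- The curvature (flecnode) polynomial of the slices `y = const`.
Variable `0` is `z`, variable `1` is `x`, variable `2` is `y`. -/
noncomputable def cur {F : Type*} [Field F] (g : MvPolynomial (Fin 3) F) :
    MvPolynomial (Fin 3) F :=
  MvPolynomial.pderiv 1 (MvPolynomial.pderiv 1 g) * MvPolynomial.pderiv 0 g ^ 2
  - MvPolynomial.C 2 * MvPolynomial.pderiv 0 (MvPolynomial.pderiv 1 g)
      * MvPolynomial.pderiv 1 g * MvPolynomial.pderiv 0 g
  + MvPolynomial.pderiv 0 (MvPolynomial.pderiv 0 g) * MvPolynomial.pderiv 1 g ^ 2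

lemma totalDegree_cur_le {F : Type*} [Field F] (g : MvPolynomial (Fin 3) F) :
    (cur g).totalDegree ≤ 3 * g.totalDegree := by
  have a0 := totalDegree_pderiv_le 0 g
  have a1 := totalDegree_pderiv_le 1 g
  have b0 := totalDegree_pderiv_le 0 (MvPolynomial.pderiv 0 g)
  have b1 := totalDegree_pderiv_le 1 (MvPolynomial.pderiv 1 g)
  have b2 := totalDegree_pderiv_le 0 (MvPolynomial.pderiv 1 g)
  unfold cur
  refine (MvPolynomial.totalDegree_add _ _).trans (max_le ?_ ?_)
  · refine (MvPolynomial.totalDegree_sub _ _).trans (max_le ?_ ?_)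
    · refine (MvPolynomial.totalDegree_mul _ _).trans ?_
      have := MvPolynomial.totalDegree_pow (MvPolynomial.pderiv 0 g) 2
      omega
    · refine (MvPolynomial.totalDegree_mul _ _).trans ?_
      have h1 := MvPolynomial.totalDegree_mul (MvPolynomial.C 2 *
        MvPolynomial.pderiv 0 (MvPolynomial.pderiv 1 g)) (MvPolynomial.pderiv 1 g)
      have h2 := MvPolynomial.totalDegree_mul (MvPolynomial.C (2 : F))
        (MvPolynomial.pderiv 0 (MvPolynomial.pderiv (1 : Fin 3) g))
      rw [MvPolynomial.totalDegree_C] at h2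
      omega
  · refine (MvPolynomial.totalDegree_mul _ _).trans ?_
    have := MvPolynomial.totalDegree_pow (MvPolynomial.pderiv 1 g) 2
    omega

open Polynomial in
/-- A line in the slice. -/
noncomputable def lin {S : Type*} [CommRing S] (w a u e y : S) : Fin 3 → S[X] :=
  ![C w + C a * X, C u + C e * X, C y]

open Polynomial in
lemma lin_deg {S : Type*} [CommRing S] (w a u e y : S) (i : Fin 3) :
    (lin w a u e y i).natDegree ≤ 1 := by
  have h : ∀ w a : S, (C w + C a * X).natDegree ≤ 1 := by
    intro w a
    compute_degree
  fin_cases i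
  · exact h w a
  · exact h u e
  · simp [lin]

open Polynomial in
lemma cur_lin {F S : Type*} [Field F] [CommRing S] [Algebra F S]
    (g : MvPolynomial (Fin 3) F) (w a u e y : S) :
    ∃ s : S[X], C e ^ 2 * MvPolynomial.aeval (lin w a u e y) (cur g) =
      (MvPolynomial.aeval (lin w a u e y) (MvPolynomial.pderiv 0 g)) ^ 2 *
        derivative (derivative (MvPolynomial.aeval (lin w a u e y) g))
      + derivative (MvPolynomial.aeval (lin w a u e y) g) * s := by
  set v := lin w a u e y with hv
  have d0 : derivative (v 0) = C a := by simp [hv, lin]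
  have d1 : derivative (v 1) = C e := by simp [hv, lin]
  have d2 : derivative (v 2) = 0 := by simp [hv, lin]
  have key : ∀ h : MvPolynomial (Fin 3) F, derivative (MvPolynomial.aeval v h) =
      MvPolynomial.aeval v (MvPolynomial.pderiv 0 h) * C a +
      MvPolynomial.aeval v (MvPolynomial.pderiv 1 h) * C e := by
    intro h
    rw [chain_rule, Fin.sum_univ_three, d0, d1, d2]; ring
  have k1 := key g
  have k2 : derivative (derivative (MvPolynomial.aeval v g)) =
      MvPolynomial.aeval v (MvPolynomial.pderiv 0 (MvPolynomial.pderiv 0 g)) * C a ^ 2 +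
      2 * MvPolynomial.aeval v (MvPolynomial.pderiv 0 (MvPolynomial.pderiv 1 g)) * C a * C e +
      MvPolynomial.aeval v (MvPolynomial.pderiv 1 (MvPolynomial.pderiv 1 g)) * C e ^ 2 := by
    rw [k1, derivative_add, derivative_mul, derivative_mul, derivative_C, derivative_C,
      key, key, pderiv_swap 1 0 g]
    ring
  refine ⟨- 2 * C e * MvPolynomial.aeval v (MvPolynomial.pderiv 0 (MvPolynomial.pderiv 1 g)) *
      MvPolynomial.aeval v (MvPolynomial.pderiv 0 g)
    + MvPolynomial.aeval v (MvPolynomial.pderiv 0 (MvPolynomial.pderiv 0 g)) *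
      (derivative (MvPolynomial.aeval v g) - 2 * C a *
        MvPolynomial.aeval v (MvPolynomial.pderiv 0 g)), ?_⟩
  have h2 : MvPolynomial.aeval v (MvPolynomial.C (2 : F)) = 2 := by rw [MvPolynomial.aeval_C, map_ofNat]
  rw [k2, k1]
  simp only [cur, map_add, map_sub, map_mul, map_pow, h2]
  ring

end MPS
open Pointwise

namespace MPS

open Polynomial in
lemma root_count {F κ : Type*} [Field F] (r : MvPolynomial (Fin 2) F) (hr : r ≠ 0)
    (s : Finset κ) (u : κ → F[X]) (hu : Set.InjOn u s)
    (h : ∀ j ∈ s, MvPolynomial.aeval ![u j, (X : F[X])] r = 0) :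
    s.card ≤ r.totalDegree := by
  classical
  let φ : MvPolynomial (Fin 2) F →ₐ[F] F[X][X] := MvPolynomial.aeval ![X, C X]
  have hdeg : (φ r).natDegree ≤ r.totalDegree := by
    apply natDegree_aeval_le
    intro i
    fin_cases i <;> simp
  let ψ : F[X][X] →+* MvPolynomial (Fin 2) F :=
    Polynomial.eval₂RingHom (aeval (MvPolynomial.X 1 : MvPolynomial (Fin 2) F)).toRingHom
      (MvPolynomial.X 0)
  have hψ : ∀ r, ψ (φ r) = r := by
    intro r
    induction r using MvPolynomial.induction_on with
    | C a => simp [φ, ψ, Polynomial.algebraMap_apply, MvPolynomial.algebraMap_eq]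
    | add p q hp hq => rw [map_add, map_add, hp, hq]
    | mul_X p i hp =>
      rw [map_mul, map_mul, hp]
      congr 1
      fin_cases i <;> simp [φ, ψ]
  have hne : φ r ≠ 0 := by
    intro h0
    apply hr
    rw [← hψ r, h0, map_zero]
  have hev : ∀ (v : F[X]) (r : MvPolynomial (Fin 2) F),
      (φ r).eval v = MvPolynomial.aeval ![v, (X : F[X])] r := by
    intro v r
    induction r using MvPolynomial.induction_on with
    | C a => simp [φ, Polynomial.algebraMap_apply]
    | add p q hp hq => rw [map_add, map_add, eval_add, hp, hq]
    | mul_X p i hp =>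
      rw [map_mul, map_mul, eval_mul, hp]
      congr 1
      fin_cases i <;> simp [φ]
  have hsub : s.image u ⊆ (φ r).roots.toFinset := by
    intro v hv
    obtain ⟨j, hj, rfl⟩ := Finset.mem_image.1 hv
    rw [Multiset.mem_toFinset, mem_roots hne, IsRoot.def, hev, h j hj]
  calc s.card = (s.image u).card := (Finset.card_image_of_injOn hu).symm
    _ ≤ (φ r).roots.toFinset.card := Finset.card_le_card hsub
    _ ≤ Multiset.card (φ r).roots := Multiset.toFinset_card_le _
    _ ≤ (φ r).natDegree := card_roots' _
    _ ≤ _ := hdeg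

open Polynomial in
lemma spec {F : Type*} [Field F] (g : MvPolynomial (Fin 3) F) (w u : F[X]) :
    MvPolynomial.aeval ![w, u, (X : F[X])] g =
      Polynomial.eval₂ (MvPolynomial.aeval ![u, (X : F[X])] :
        MvPolynomial (Fin 2) F →ₐ[F] F[X]).toRingHom w (MvPolynomial.finSuccEquiv F 2 g) := by
  induction g using MvPolynomial.induction_on with
  | C a => simp [MvPolynomial.finSuccEquiv_apply, Polynomial.algebraMap_apply]
  | add p q hp hq => rw [map_add, map_add, eval₂_add, hp, hq]
  | mul_X p i hp =>
    rw [map_mul, map_mul, eval₂_mul, hp]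
    congr 1
    induction i using Fin.cases with
    | zero => rw [MvPolynomial.finSuccEquiv_X_zero]; simp
    | succ i =>
      rw [MvPolynomial.finSuccEquiv_X_succ, eval₂_C]
      fin_cases i <;> simp

lemma totalDegree_coeff_fse_le {F : Type*} [Field F] (g : MvPolynomial (Fin 3) F) (i : ℕ) :
    ((MvPolynomial.finSuccEquiv F 2 g).coeff i).totalDegree ≤ g.totalDegree := by
  by_cases h : (MvPolynomial.finSuccEquiv F 2 g).coeff i = 0
  · simp [h]
  · have := MvPolynomial.totalDegree_coeff_finSuccEquiv_add_le g i h
    omega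

lemma natDegree_fse_le {F : Type*} [Field F] (g : MvPolynomial (Fin 3) F) :
    (MvPolynomial.finSuccEquiv F 2 g).natDegree ≤ g.totalDegree := by
  by_cases h : g = 0
  · simp [h]
  · have := MvPolynomial.totalDegree_coeff_finSuccEquiv_add_le g
      (MvPolynomial.finSuccEquiv F 2 g).natDegree (by
        rw [Polynomial.coeff_natDegree, Polynomial.leadingCoeff_ne_zero]
        simpa using h)
    omega

lemma totalDegree_resultant_le {F : Type*} [Field F]
    (f g : Polynomial (MvPolynomial (Fin 2) F)) (m n D E : ℕ)
    (hf : ∀ i, (f.coeff i).totalDegree ≤ D) (hg : ∀ i, (g.coeff i).totalDegree ≤ E) :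
    (Polynomial.resultant f g m n).totalDegree ≤ m * E + n * D := by
  rw [Polynomial.resultant, Matrix.det_apply]
  apply MvPolynomial.totalDegree_finsetSum_le
  intro σ _
  refine (show _ ≤ _ from ?_ : _ ≤ (∏ i, Polynomial.sylvester f g m n (σ i) i).totalDegree).trans ?_
  · rcases Int.units_eq_one_or (Equiv.Perm.sign σ) with h | h
    · rw [h, one_smul]
    · rw [h, Units.neg_smul, one_smul, MvPolynomial.totalDegree_neg]
  refine (MvPolynomial.totalDegree_finsetProd _ _).trans ?_
  rw [Fin.sum_univ_add]
  apply add_le_add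
  · refine (Finset.sum_le_card_nsmul _ _ E ?_).trans (by simp)
    intro i _
    simp only [Polynomial.sylvester, Matrix.of_apply, Fin.addCases_left]
    split_ifs
    · exact hg _
    · simp
  · refine (Finset.sum_le_card_nsmul _ _ D ?_).trans (by simp)
    intro i _
    simp only [Polynomial.sylvester, Matrix.of_apply, Fin.addCases_right]
    split_ifs
    · exact hf _
    · simp

open Polynomial in
lemma resultant_ne_zero {R : Type*} [CommRing R] [IsDomain R] [UniqueFactorizationMonoid R]
    (f g : R[X]) (hf : Irreducible f) (h0 : f.natDegree ≠ 0) (hd : ¬ f ∣ g) :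
    resultant f g ≠ 0 := by
  classical
  obtain ⟨inst⟩ : Nonempty (NormalizedGCDMonoid R) := inferInstance
  let K := FractionRing R
  have hp := hf.isPrimitive h0
  have hirr := (hp.irreducible_iff_irreducible_map_fraction_map (K := K)).1 hf
  have hd' := mt (hp.dvd_iff_fraction_map_dvd_fraction_map K (q := g)).2 hd
  have hco := (hirr.coprime_iff_not_dvd).2 hd'
  intro hres
  have hinj : Function.Injective (algebraMap R K) := IsFractionRing.injective R K
  have h1 : resultant (f.map (algebraMap R K)) (g.map (algebraMap R K)) = 0 := by
    have := resultant_map_map f g f.natDegree g.natDegree (algebraMap R K)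
    rw [hres, map_zero] at this
    rwa [natDegree_map_eq_of_injective hinj, natDegree_map_eq_of_injective hinj]
  rw [resultant_eq_zero_iff] at h1
  exact h1.2 hco

open Polynomial in
lemma bezout {F κ : Type*} [Field F] (g G : MvPolynomial (Fin 3) F) (hg : Irreducible g)
    (h0 : MvPolynomial.degreeOf 0 g ≠ 0) (hd : ¬ g ∣ G)
    (s : Finset κ) (w u : κ → F[X]) (hu : Set.InjOn u s)
    (h1 : ∀ j ∈ s, MvPolynomial.aeval ![w j, u j, (X : F[X])] g = 0)
    (h2 : ∀ j ∈ s, MvPolynomial.aeval ![w j, u j, (X : F[X])] G = 0) :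
    s.card ≤ 2 * g.totalDegree * G.totalDegree := by
  classical
  set e := MvPolynomial.finSuccEquiv F 2
  have hg' : Irreducible (e g) := (MulEquiv.irreducible_iff e.toMulEquiv).2 hg
  have h0' : (e g).natDegree ≠ 0 := by rwa [MvPolynomial.natDegree_finSuccEquiv]
  have hd' : ¬ e g ∣ e G := by rwa [map_dvd_iff]
  have hr := resultant_ne_zero _ _ hg' h0' hd'
  obtain ⟨a, b, -, -, hab⟩ := exists_mul_add_mul_eq_C_resultant (e g) (e G) le_rfl le_rfl
    (Or.inl h0')
  have hroot : ∀ j ∈ s, MvPolynomial.aeval ![u j, (X : F[X])] (resultant (e g) (e G)) = 0 := by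
    intro j hj
    have := congrArg (Polynomial.eval₂ (MvPolynomial.aeval ![u j, (X : F[X])] :
        MvPolynomial (Fin 2) F →ₐ[F] F[X]).toRingHom (w j)) hab
    rw [eval₂_add, eval₂_mul, eval₂_mul, ← spec, ← spec, h1 j hj, h2 j hj, eval₂_C] at this
    simpa using this.symm
  refine (root_count _ hr s u hu hroot).trans ?_
  refine (totalDegree_resultant_le _ _ _ _ _ _ (totalDegree_coeff_fse_le g)
    (totalDegree_coeff_fse_le G)).trans ?_
  have e1 : (e g).natDegree ≤ _ := natDegree_fse_le g
  have e2 : (e G).natDegree ≤ _ := natDegree_fse_le G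
  calc (e g).natDegree * G.totalDegree + (e G).natDegree * g.totalDegree
      ≤ g.totalDegree * G.totalDegree + G.totalDegree * g.totalDegree := by gcongr
    _ = _ := by ring

open Polynomial in
lemma bezout_zero {F κ : Type*} [Field F] (g : MvPolynomial (Fin 3) F) (hg : g ≠ 0)
    (h0 : MvPolynomial.degreeOf 0 g = 0)
    (s : Finset κ) (w u : κ → F[X]) (hu : Set.InjOn u s)
    (h1 : ∀ j ∈ s, MvPolynomial.aeval ![w j, u j, (X : F[X])] g = 0) :
    s.card ≤ g.totalDegree := by
  classical
  have h0' : (MvPolynomial.finSuccEquiv F 2 g).natDegree = 0 := by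
    rwa [MvPolynomial.natDegree_finSuccEquiv]
  have hC := eq_C_of_natDegree_eq_zero h0'
  have hne : (MvPolynomial.finSuccEquiv F 2 g).coeff 0 ≠ 0 := by
    intro h
    rw [h, C_0] at hC
    exact hg (by simpa using hC)
  refine (root_count _ hne s u hu ?_).trans (totalDegree_coeff_fse_le g 0)
  intro j hj
  have := h1 j hj
  rw [spec, hC, eval₂_C] at this
  exact this

end MPS
open Pointwise

namespace MPS

open Polynomial in
/-- A nonzero polynomial restricted to a doubly osculating line whose curvature vanishes. -/
lemma osc_line {S : Type*} [CommRing S] [IsDomain S] (p : ℕ) [CharP S p]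
    (φ E Z s : S[X]) (hdeg : φ.natDegree < p) (h0 : φ.coeff 0 = 0)
    (h1 : (derivative φ).coeff 0 = 0) (hE : E.coeff 0 ≠ 0) (hZ : φ ∣ Z)
    (h : Z = E ^ 2 * derivative (derivative φ) + derivative φ * s) : φ = 0 := by
  by_contra hφ
  obtain ⟨n, hn⟩ : ∃ n, n = φ.natTrailingDegree := ⟨_, rfl⟩
  have hlow : ∀ m < n, φ.coeff m = 0 := by
    intro m hm
    rw [hn] at hm
    exact coeff_eq_zero_of_lt_natTrailingDegree hm
  have hcn : φ.coeff n ≠ 0 := by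
    rw [hn]
    exact (mt trailingCoeff_eq_zero.1 hφ)
  have hnp : n < p := lt_of_le_of_lt (by rw [hn]; exact natTrailingDegree_le_natDegree φ) hdeg
  have h1' : φ.coeff 1 = 0 := by
    rw [coeff_derivative] at h1
    simpa using h1
  have hn2 : 2 ≤ n := by
    by_contra hlt
    interval_cases n
    · exact hcn h0
    · exact hcn h1'
  obtain ⟨k, rfl⟩ : ∃ k, n = k + 2 := ⟨n - 2, by omega⟩
  have d1 : X ^ (k + 1) ∣ derivative φ := by
    rw [X_pow_dvd_iff]
    intro d hd
    rw [coeff_derivative, hlow (d + 1) (by omega), zero_mul]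
  have d2 : X ^ (k + 1) ∣ Z := by
    refine Dvd.dvd.trans ?_ hZ
    rw [X_pow_dvd_iff]
    intro d hd
    exact hlow d (by omega)
  have d3 : X ^ (k + 1) ∣ E ^ 2 * derivative (derivative φ) := by
    have : E ^ 2 * derivative (derivative φ) = Z - derivative φ * s := by rw [h]; ring
    rw [this]
    exact dvd_sub d2 (d1.mul_right s)
  have hE2 : ¬ (X : S[X]) ∣ E ^ 2 := by
    intro hx
    have := prime_X.dvd_of_dvd_pow hx
    rw [X_dvd_iff] at this
    exact hE this
  have d4 := prime_X.pow_dvd_of_dvd_mul_left (k + 1) hE2 d3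
  rw [X_pow_dvd_iff] at d4
  have d5 := d4 k (by omega)
  rw [coeff_derivative, coeff_derivative] at d5
  have hc : ∀ m : ℕ, 0 < m → m < p → (m : S) ≠ 0 := by
    intro m hm hmp hz
    rw [CharP.cast_eq_zero_iff S p] at hz
    exact absurd (Nat.le_of_dvd hm hz) (by omega)
  have c1 := hc (k + 1) (by omega) (by omega)
  have c2 := hc (k + 1 + 1) (by omega) (by omega)
  push_cast at c1 c2 d5
  exact mul_ne_zero (mul_ne_zero hcn c2) c1 d5

open Polynomial in
lemma card_le_of_roots {F ι : Type*} [Field F] (q : F[X]) (hq : q ≠ 0) (s : Finset ι)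
    (y : ι → F) (hy : Set.InjOn y s) (h : ∀ i ∈ s, q.eval (y i) = 0) :
    s.card ≤ q.natDegree := by
  classical
  rw [← Finset.card_image_of_injOn hy]
  refine (Finset.card_le_card ?_).trans ((Multiset.toFinset_card_le q.roots).trans
    (card_roots' q))
  intro v hv
  obtain ⟨j, hj, rfl⟩ := Finset.mem_image.1 hv
  rw [Multiset.mem_toFinset, mem_roots hq, IsRoot.def, h j hj]

open Polynomial in
lemma eval_aeval {F S : Type*} [Field F] [CommRing S] [Algebra F S]
    (g : MvPolynomial (Fin 3) F) (v : Fin 3 → S[X]) (t : S) :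
    (MvPolynomial.aeval v g).eval t = MvPolynomial.aeval (fun k => (v k).eval t) g := by
  induction g using MvPolynomial.induction_on with
  | C a => simp [Polynomial.algebraMap_apply]
  | add p q hp hq => rw [map_add, map_add, eval_add, hp, hq]
  | mul_X p i hp =>
    rw [map_mul, map_mul, eval_mul, hp]
    simp

lemma vec3 {S : Type*} {a b c : S} {f : Fin 3 → S} (h0 : f 0 = a) (h1 : f 1 = b)
    (h2 : f 2 = c) : f = ![a, b, c] := by
  funext i
  fin_cases i
  · exact h0
  · exact h1
  · exact h2

open Polynomial in
lemma eval_lin {F S : Type*} [Field F] [CommRing S] [Algebra F S]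
    (g : MvPolynomial (Fin 3) F) (w a u e y t : S) :
    (MvPolynomial.aeval (lin w a u e y) g).eval t =
      MvPolynomial.aeval ![w + a * t, u + e * t, y] g := by
  rw [eval_aeval, vec3 (f := fun k => eval t (lin w a u e y k)) (a := w + a * t)
    (b := u + e * t) (c := y)] <;> simp [lin]

/-- A configuration of two families of lines. -/
structure Cfg (F ι κ : Type*) where
  y : ι → F
  m : ι → F
  c : ι → F
  x : κ → F
  n : κ → F
  d : κ → F

namespace Cfg

variable {F ι κ : Type*} [Field F] (K : Cfg F ι κ)

/-- incidence -/
def adj (i : ι) (j : κ) : Prop := K.m i * K.x j + K.c i = K.n j * K.y i + K.d j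

/-- the line `i` lies on the surface -/
def onA (g : MvPolynomial (Fin 3) F) (i : ι) : Prop :=
  MvPolynomial.aeval (lin (K.c i) (K.m i) 0 1 (K.y i)) g = 0

open Polynomial in
/-- height of line `j` -/
noncomputable def w (j : κ) : F[X] := C (K.d j) + C (K.n j) * X

open Polynomial in
/-- the line `j` lies on the surface -/
def onB (g : MvPolynomial (Fin 3) F) (j : κ) : Prop :=
  MvPolynomial.aeval ![K.w j, C (K.x j), (X : F[X])] g = 0

open scoped Classical in
/-- number of incidences -/
noncomputable def I (a : Finset ι) (b : Finset κ) : ℕ :=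
  ∑ j ∈ b, (a.filter (fun i => K.adj i j)).card

/-- hypotheses on a configuration -/
structure Good (α : Finset ι) (β : Finset κ) (k : ℕ) : Prop where
  hx : Set.InjOn K.x β
  h1 : ∀ j ∈ β, ∀ i ∈ α, ∀ i' ∈ α, K.adj i j → K.adj i' j → K.y i = K.y i' → i = i'
  h2 : ∀ j ∈ β, ∀ j' ∈ β, j ≠ j' → ∀ s ⊆ α, (∀ i ∈ s, K.adj i j ∧ K.adj i j') → s.card ≤ k

variable {K} in
lemma Good.mono {α α' : Finset ι} {β β' : Finset κ} {k : ℕ} (h : K.Good α β k)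
    (ha : α' ⊆ α) (hb : β' ⊆ β) : K.Good α' β' k where
  hx := h.hx.mono (by exact_mod_cast hb)
  h1 := fun j hj i hi i' hi' => h.h1 j (hb hj) i (ha hi) i' (ha hi')
  h2 := fun j hj j' hj' hne s hs => h.h2 j (hb hj) j' (hb hj') hne s (hs.trans ha)

open Polynomial in
lemma evalA (g : MvPolynomial (Fin 3) F) (i : ι) (t : F) :
    (MvPolynomial.aeval (lin (K.c i) (K.m i) 0 1 (K.y i)) g).eval t =
      MvPolynomial.aeval ![K.m i * t + K.c i, t, K.y i] g := by
  rw [eval_lin, zero_add, one_mul, add_comm]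

open Polynomial in
lemma evalB (g : MvPolynomial (Fin 3) F) (j : κ) (t : F) :
    (MvPolynomial.aeval ![K.w j, C (K.x j), (X : F[X])] g).eval t =
      MvPolynomial.aeval ![K.n j * t + K.d j, K.x j, t] g := by
  rw [eval_aeval, vec3 (f := fun k => eval t (![K.w j, C (K.x j), (X : F[X])] k))
    (a := K.n j * t + K.d j) (b := K.x j) (c := t)] <;> simp [w, add_comm]

open Polynomial in
lemma degB (g : MvPolynomial (Fin 3) F) (j : κ) :
    (MvPolynomial.aeval ![K.w j, C (K.x j), (X : F[X])] g).natDegree ≤ g.totalDegree := by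
  apply natDegree_aeval_le
  intro i
  fin_cases i
  · simp only [w]
    show (C (K.d j) + C (K.n j) * X).natDegree ≤ 1
    compute_degree
  · simp
  · simp

open scoped Classical in
lemma smallB {α : Finset ι} {β : Finset κ} {k : ℕ} (h : K.Good α β k)
    (G : MvPolynomial (Fin 3) F) (hG : ∀ i ∈ α, K.onA G i) (j : κ) (hj : j ∈ β)
    (hn : ¬ K.onB G j) : (α.filter (fun i => K.adj i j)).card ≤ G.totalDegree := by
  refine (card_le_of_roots _ hn _ K.y ?_ ?_).trans (K.degB G j)
  · intro i hi i' hi' hy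
    simp only [Finset.coe_filter, Set.mem_ofPred_eq] at hi hi'
    exact h.h1 j hj i hi.1 i' hi'.1 hi.2 hi'.2 hy
  · intro i hi
    rw [Finset.mem_filter] at hi
    have h1 := K.evalA G i (K.x j)
    rw [hG i hi.1, hi.2] at h1
    rw [K.evalB, ← h1, Polynomial.eval_zero]

open scoped Classical in
lemma smallA {β : Finset κ} (hx : Set.InjOn K.x β)
    (G : MvPolynomial (Fin 3) F) (hG : ∀ j ∈ β, K.onB G j) (i : ι)
    (hn : ¬ K.onA G i) : (β.filter (fun j => K.adj i j)).card ≤ G.totalDegree := by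
  refine (card_le_of_roots _ hn _ K.x (hx.mono ?_) ?_).trans
    (natDegree_aeval_le _ _ (lin_deg _ _ _ _ _))
  · intro j hj
    exact (Finset.mem_filter.1 hj).1
  · intro j hj
    rw [Finset.mem_filter] at hj
    have h1 := K.evalB G j (K.y i)
    rw [hG j hj.1, ← hj.2] at h1
    rw [K.evalA, ← h1, Polynomial.eval_zero]

open scoped Classical in
lemma I_comm (a : Finset ι) (b : Finset κ) :
    K.I a b = ∑ i ∈ a, (b.filter (fun j => K.adj i j)).card := by
  unfold I
  exact (Finset.sum_card_bipartiteAbove_eq_sum_card_bipartiteBelow K.adj).symm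

lemma C_inj_on {β : Finset κ} (hx : Set.InjOn K.x β) :
    Set.InjOn (fun j => Polynomial.C (K.x j)) β :=
  fun _ hj _ hj' h => hx hj hj' (Polynomial.C_injective h)

open Polynomial in
/-- Ruled case: `g` divides its curvature. -/
lemma tangent_dvd [Infinite F] (p : ℕ) [CharP F p] (g : MvPolynomial (Fin 3) F)
    (hg : Irreducible g) (hdeg : g.totalDegree < p) (hz : MvPolynomial.degreeOf 0 g ≠ 0)
    (hcur : g ∣ cur g) (w x1 e a : F[X])
    (h0 : MvPolynomial.aeval ![w, x1, (X : F[X])] g = 0)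
    (he : e = MvPolynomial.aeval ![w, x1, (X : F[X])] (MvPolynomial.pderiv 0 g))
    (ha : a = - MvPolynomial.aeval ![w, x1, (X : F[X])] (MvPolynomial.pderiv 1 g))
    (hne : e ≠ 0) :
    g ∣ aeval (MvPolynomial.X 2 : MvPolynomial (Fin 3) F) e *
        (MvPolynomial.X 0 - aeval (MvPolynomial.X 2) w)
      - aeval (MvPolynomial.X 2) a * (MvPolynomial.X 1 - aeval (MvPolynomial.X 2) x1) := by
  have hφ : MvPolynomial.aeval (lin w a x1 e (X : F[X])) g = 0 := by
    obtain ⟨s, hs⟩ := cur_lin g w a x1 e (X : F[X])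
    refine osc_line p _ (MvPolynomial.aeval (lin w a x1 e (X : F[X])) (MvPolynomial.pderiv 0 g))
      _ s ?_ ?_ ?_ ?_ ?_ hs
    · exact lt_of_le_of_lt (natDegree_aeval_le _ _ (lin_deg _ _ _ _ _)) hdeg
    · rw [coeff_zero_eq_eval_zero, eval_lin]
      simpa using h0
    · rw [chain_rule, Fin.sum_univ_three, coeff_zero_eq_eval_zero, eval_add, eval_add, eval_mul,
        eval_mul, eval_mul, eval_lin, eval_lin]
      simp only [mul_zero, add_zero]
      rw [← he, ← neg_eq_iff_eq_neg.2 ha]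
      simp [lin]
      ring
    · rw [coeff_zero_eq_eval_zero, eval_lin]
      simp only [mul_zero, add_zero]
      rwa [← he]
    · obtain ⟨q, hq⟩ := hcur
      rw [hq, map_mul]
      exact (dvd_mul_right _ _).mul_left _
  by_contra hnd
  obtain ⟨h, hh⟩ : ∃ h : MvPolynomial (Fin 3) F,
      h = aeval (MvPolynomial.X 2 : MvPolynomial (Fin 3) F) e *
        (MvPolynomial.X 0 - aeval (MvPolynomial.X 2) w)
      - aeval (MvPolynomial.X 2) a * (MvPolynomial.X 1 - aeval (MvPolynomial.X 2) x1) := ⟨_, rfl⟩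
  rw [← hh] at hnd
  obtain ⟨s, hs⟩ := Infinite.exists_subset_card_eq F (2 * g.totalDegree * h.totalDegree + 1)
  have key := bezout g h hg hz hnd s (fun l => w + a * C l) (fun l => x1 + e * C l) ?_ ?_ ?_
  · omega
  · intro l _ l' _ hl
    simp only [add_right_inj] at hl
    exact C_injective (mul_left_cancel₀ hne hl)
  · intro l _
    have := eval_lin g w a x1 e (X : F[X]) (C l)
    rw [hφ] at this
    rw [← this, eval_zero]
  · intro l _
    have hX : ∀ (v : Fin 3 → F[X]) (hv : v 2 = X) (q : F[X]),
        MvPolynomial.aeval v (aeval (MvPolynomial.X 2 : MvPolynomial (Fin 3) F) q) = q := by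
      intro v hv q
      rw [← Polynomial.aeval_algHom_apply, MvPolynomial.aeval_X, hv, Polynomial.aeval_X_left_apply]
    rw [hh, map_sub, map_mul, map_mul, map_sub, map_sub, hX _ (by rfl), hX _ (by rfl),
      hX _ (by rfl), hX _ (by rfl), MvPolynomial.aeval_X, MvPolynomial.aeval_X]
    simp
    ring

end Cfg

end MPS
open Pointwise

namespace MPS

namespace Cfg

variable {F ι κ : Type*} [Field F] (K : Cfg F ι κ)

lemma one_le_totalDegree (g : MvPolynomial (Fin 3) F) (hg : Irreducible g) :
    1 ≤ g.totalDegree := by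
  by_contra h
  have h0 : g.totalDegree = 0 := by omega
  rw [MvPolynomial.totalDegree_eq_zero_iff_eq_C] at h0
  apply hg.not_isUnit
  rw [h0]
  have : MvPolynomial.coeff 0 g ≠ 0 := by
    intro hc
    rw [hc, map_zero] at h0
    exact hg.ne_zero h0
  exact (isUnit_iff_ne_zero.2 this).map MvPolynomial.C

lemma I_le_of (α : Finset ι) (β : Finset κ) (N : ℕ)
    (h : ∀ j ∈ β, ∀ s ⊆ α, (∀ i ∈ s, K.adj i j) → s.card ≤ N) : K.I α β ≤ N * β.card := by
  classical
  unfold I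
  refine (Finset.sum_le_card_nsmul _ _ N ?_).trans (by rw [smul_eq_mul, mul_comm])
  intro j hj
  exact h j hj _ (Finset.filter_subset _ _) (fun i hi => (Finset.mem_filter.1 hi).2)

lemma I_mono {α α' : Finset ι} {β β' : Finset κ} (ha : α ⊆ α') (hb : β ⊆ β') :
    K.I α β ≤ K.I α' β' := by
  classical
  unfold I
  refine (Finset.sum_le_sum (fun j _ => ?_)).trans (Finset.sum_le_sum_of_subset hb)
  exact Finset.card_le_card (Finset.filter_subset_filter _ ha)

lemma I_empty (α : Finset ι) : K.I α ∅ = 0 := by simp [I]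

open Polynomial in
lemma onA_dvd {g h : MvPolynomial (Fin 3) F} (hd : g ∣ h) {i : ι} (hi : K.onA g i) :
    K.onA h i := by
  obtain ⟨q, rfl⟩ := hd
  unfold onA at *
  rw [map_mul, hi, zero_mul]

open Polynomial in
lemma onB_dvd {g h : MvPolynomial (Fin 3) F} (hd : g ∣ h) {j : κ} (hj : K.onB g j) :
    K.onB h j := by
  obtain ⟨q, rfl⟩ := hd
  unfold onB at *
  rw [map_mul, hj, zero_mul]

lemma onA_cur {g : MvPolynomial (Fin 3) F} {i : ι} (hi : K.onA g i) : K.onA (cur g) i := by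
  obtain ⟨s, hs⟩ := cur_lin g (K.c i) (K.m i) 0 1 (K.y i)
  unfold onA at *
  rw [hi] at hs
  simpa using hs

open Polynomial in
/-- Ruled case: planes. -/
lemma ruled_case [Infinite F] (p : ℕ) [CharP F p] (g : MvPolynomial (Fin 3) F)
    (hg : Irreducible g) (hdeg : g.totalDegree < p) (hz : MvPolynomial.degreeOf 0 g ≠ 0)
    (hcur : g ∣ cur g) {α : Finset ι} {β : Finset κ} {k : ℕ} (h : K.Good α β k)
    (hA : ∀ i ∈ α, K.onA g i) (hB : ∀ j ∈ β, K.onB g j) (hβ : 2 ≤ β.card)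
    (j₁ : κ) (hj₁ : j₁ ∈ β) (hne : ¬ K.onB (MvPolynomial.pderiv 0 g) j₁) :
    K.I α β ≤ (g.totalDegree + k) * β.card := by
  classical
  obtain ⟨e, he⟩ : ∃ e, e = MvPolynomial.aeval ![K.w j₁, C (K.x j₁), (X : F[X])]
    (MvPolynomial.pderiv 0 g) := ⟨_, rfl⟩
  obtain ⟨a, ha⟩ : ∃ a, a = - MvPolynomial.aeval ![K.w j₁, C (K.x j₁), (X : F[X])]
    (MvPolynomial.pderiv 1 g) := ⟨_, rfl⟩
  have he0 : e ≠ 0 := by rw [he]; exact hne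
  have hdiv := tangent_dvd p g hg hdeg hz hcur (K.w j₁) (C (K.x j₁)) e a (hB j₁ hj₁) he ha he0
  have hedeg : e.natDegree ≤ g.totalDegree := by
    rw [he]
    exact (K.degB _ _).trans (totalDegree_pderiv_le _ _)
  have hX : ∀ (v : Fin 3 → F[X]) (q : F[X]),
      MvPolynomial.aeval v (aeval (MvPolynomial.X 2 : MvPolynomial (Fin 3) F) q) =
        aeval (v 2) q := by
    intro v q
    rw [← Polynomial.aeval_algHom_apply, MvPolynomial.aeval_X]
  have keyB : ∀ l ∈ β, e * (K.w l - K.w j₁) = a * (C (K.x l) - C (K.x j₁)) := by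
    intro l hl
    have h1 := K.onB_dvd hdiv (hB l hl)
    unfold onB at h1
    rw [map_sub, map_mul, map_mul, map_sub, map_sub, hX, hX, hX, hX,
      MvPolynomial.aeval_X, MvPolynomial.aeval_X, sub_eq_zero] at h1
    simpa using h1
  have keyA : ∀ i ∈ α, e.eval (K.y i) ≠ 0 → ∀ l ∈ β, K.adj i l := by
    intro i hi hei l hl
    have h1 := K.onA_dvd hdiv (hA i hi)
    unfold onA at h1
    rw [map_sub, map_mul, map_mul, map_sub, map_sub, hX, hX, hX, hX,
      MvPolynomial.aeval_X, MvPolynomial.aeval_X, sub_eq_zero] at h1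
    have hc : ∀ q : F[X], (aeval (C (K.y i))) q = C (q.eval (K.y i)) := by
      intro q
      rw [Polynomial.aeval_def, Polynomial.algebraMap_eq, Polynomial.eval₂_at_apply]
    have h2 := congrArg (Polynomial.eval (K.x l)) h1
    simp only [lin, Matrix.cons_val, hc, eval_mul, eval_sub, eval_add, eval_C, eval_X] at h2
    have h3 := congrArg (Polynomial.eval (K.y i)) (keyB l hl)
    simp only [eval_mul, eval_sub, eval_C] at h3
    unfold adj
    apply mul_left_cancel₀ hei
    have h4 : (K.w l).eval (K.y i) = K.n l * K.y i + K.d l := by simp [w, add_comm]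
    rw [h4] at h3
    linear_combination h2 - h3
  apply I_le_of
  intro j hj s hs hadj
  have hs1 : (s.filter (fun i => e.eval (K.y i) = 0)).card ≤ g.totalDegree := by
    refine (card_le_of_roots e he0 _ K.y ?_ ?_).trans hedeg
    · intro i hi i' hi' hy
      simp only [Finset.coe_filter, Set.mem_ofPred_eq] at hi hi'
      exact h.h1 j hj i (hs hi.1) i' (hs hi'.1) (hadj i hi.1) (hadj i' hi'.1) hy
    · intro i hi
      exact (Finset.mem_filter.1 hi).2
  have hs2 : (s.filter (fun i => ¬ e.eval (K.y i) = 0)).card ≤ k := by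
    obtain ⟨j', hj', hjj⟩ := Finset.exists_mem_ne (show 1 < β.card by omega) j
    refine h.h2 j hj j' hj' hjj.symm _ ((Finset.filter_subset _ _).trans hs) ?_
    intro i hi
    rw [Finset.mem_filter] at hi
    exact ⟨keyA i (hs hi.1) hi.2 j hj, keyA i (hs hi.1) hi.2 j' hj'⟩
  rw [← Finset.card_filter_add_card_filter_not (s := s) (fun i => e.eval (K.y i) = 0)]
  exact add_le_add hs1 hs2

lemma bezoutB (g G : MvPolynomial (Fin 3) F) (hg : Irreducible g)
    (h0 : MvPolynomial.degreeOf 0 g ≠ 0) (hd : ¬ g ∣ G) {β : Finset κ} (hx : Set.InjOn K.x β)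
    (h1 : ∀ j ∈ β, K.onB g j) (s : Finset κ) (hs : ∀ j ∈ s, j ∈ β ∧ K.onB G j) :
    s.card ≤ 2 * g.totalDegree * G.totalDegree :=
  bezout g G hg h0 hd s K.w (fun j => Polynomial.C (K.x j))
    ((K.C_inj_on hx).mono (fun j hj => (hs j hj).1)) (fun j hj => h1 j (hs j hj).1)
    (fun j hj => (hs j hj).2)

open scoped Classical in
lemma irr_case [Infinite F] (p : ℕ) [CharP F p] (g : MvPolynomial (Fin 3) F)
    (hg : Irreducible g) (hdeg : g.totalDegree < p)
    {α : Finset ι} {β : Finset κ} {k : ℕ} (h : K.Good α β k)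
    (hA : ∀ i ∈ α, K.onA g i) (hB : ∀ j ∈ β, K.onB g j) :
    ∃ b ⊆ β, b.card ≤ 8 * g.totalDegree ^ 2 ∧
      K.I α (β \ b) ≤ (4 * g.totalDegree + k) * β.card := by
  have hD := one_le_totalDegree g hg
  have hsq : g.totalDegree ≤ g.totalDegree ^ 2 := Nat.le_self_pow (by norm_num) _
  have all : β.card ≤ 8 * g.totalDegree ^ 2 → ∃ b ⊆ β, b.card ≤ 8 * g.totalDegree ^ 2 ∧
      K.I α (β \ b) ≤ (4 * g.totalDegree + k) * β.card := by
    intro hc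
    refine ⟨β, subset_rfl, hc, ?_⟩
    rw [Finset.sdiff_self, I_empty]
    exact Nat.zero_le _
  have hxC := K.C_inj_on h.hx
  by_cases hz : MvPolynomial.degreeOf 0 g = 0
  · apply all
    have := bezout_zero g hg.ne_zero hz β K.w (fun j => Polynomial.C (K.x j)) hxC hB
    omega
  by_cases hβ : β.card < 2
  · apply all
    omega
  have hpd : MvPolynomial.pderiv 0 g ≠ 0 := fun h0 =>
    hz (degreeOf_eq_zero_of_pderiv p g hdeg h0)
  have hnd : ¬ g ∣ MvPolynomial.pderiv 0 g := by
    intro hd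
    have h1 := MvPolynomial.totalDegree_le_of_dvd_of_isDomain hd hpd
    have h2 := totalDegree_pderiv_succ_le 0 g hpd
    omega
  have b1 : (β.filter (fun j => K.onB (MvPolynomial.pderiv 0 g) j)).card
      ≤ 2 * g.totalDegree * g.totalDegree := by
    refine (K.bezoutB g _ hg hz hnd h.hx hB _ (fun j hj => Finset.mem_filter.1 hj)).trans ?_
    exact Nat.mul_le_mul_left _ (totalDegree_pderiv_le _ _)
  by_cases hcur : g ∣ cur g
  · by_cases hex : ∃ j₁ ∈ β, ¬ K.onB (MvPolynomial.pderiv 0 g) j₁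
    · obtain ⟨j₁, hj₁, hne⟩ := hex
      refine ⟨∅, Finset.empty_subset _, by simp, ?_⟩
      rw [Finset.sdiff_empty]
      refine (K.ruled_case p g hg hdeg hz hcur h hA hB (by omega) j₁ hj₁ hne).trans ?_
      exact Nat.mul_le_mul_right _ (by omega)
    · push Not at hex
      apply all
      rw [Finset.filter_true_of_mem hex] at b1
      nlinarith
  · refine ⟨β.filter (fun j => K.onB (cur g) j), Finset.filter_subset _ _, ?_, ?_⟩
    · refine (K.bezoutB g _ hg hz hcur h.hx hB _ (fun j hj => Finset.mem_filter.1 hj)).trans ?_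
      have := totalDegree_cur_le g
      calc 2 * g.totalDegree * (cur g).totalDegree
          ≤ 2 * g.totalDegree * (3 * g.totalDegree) := Nat.mul_le_mul_left _ this
        _ ≤ _ := by nlinarith
    · refine (K.I_le_of α _ (4 * g.totalDegree + k) ?_).trans
        (Nat.mul_le_mul_left _ (Finset.card_le_card Finset.sdiff_subset))
      intro j hj s hs hadj
      rw [Finset.mem_sdiff, Finset.mem_filter, not_and] at hj
      have h1 := K.smallB h (cur g) (fun i hi => K.onA_cur (hA i hi)) j hj.1 (hj.2 hj.1)
      have h2 : s ⊆ α.filter (fun i => K.adj i j) := fun i hi =>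
        Finset.mem_filter.2 ⟨hs hi, hadj i hi⟩
      have h3 := Finset.card_le_card h2
      have h4 := totalDegree_cur_le g
      omega

open scoped Classical in
lemma I_split (a₁ a₂ : Finset ι) (b₁ b₂ : Finset κ) (hb : Disjoint b₁ b₂)
    (ha : Disjoint a₁ a₂) :
    K.I (a₁ ∪ a₂) (b₁ ∪ b₂) = K.I a₁ b₁ + K.I a₁ b₂ + K.I a₂ b₁ + K.I a₂ b₂ := by
  have h1 : ∀ b, K.I (a₁ ∪ a₂) b = K.I a₁ b + K.I a₂ b := by
    intro b
    rw [I_comm, I_comm, I_comm, Finset.sum_union ha]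
  have h2 : ∀ a, K.I a (b₁ ∪ b₂) = K.I a b₁ + K.I a b₂ := by
    intro a
    unfold I
    rw [Finset.sum_union hb]
  rw [h1, h2, h2]
  ring

open scoped Classical in
/-- Incidences among lines contained in a surface. -/
lemma surface_case [Infinite F] (p : ℕ) [CharP F p] (f : MvPolynomial (Fin 3) F) :
    f ≠ 0 → f.totalDegree < p → ∀ {α : Finset ι} {β : Finset κ} {k : ℕ} (_ : K.Good α β k)
    (_ : ∀ i ∈ α, K.onA f i) (_ : ∀ j ∈ β, K.onB f j),
    ∃ b ⊆ β, b.card ≤ 8 * f.totalDegree ^ 2 ∧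
      K.I α (β \ b) ≤ f.totalDegree * α.card + (5 * f.totalDegree + k) * β.card := by
  induction f using WfDvdMonoid.induction_on_irreducible with
  | zero => intro h; exact absurd rfl h
  | unit u hu =>
    intro _ _ α β k _ hA _
    refine ⟨∅, Finset.empty_subset _, by simp, ?_⟩
    have : α = ∅ := by
      rw [Finset.eq_empty_iff_forall_notMem]
      intro i hi
      have h1 := hA i hi
      have h2 : IsUnit (MvPolynomial.aeval (lin (K.c i) (K.m i) 0 1 (K.y i)) u) := hu.map _
      rw [show MvPolynomial.aeval (lin (K.c i) (K.m i) 0 1 (K.y i)) u = 0 from h1] at h2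
      exact not_isUnit_zero h2
    rw [I_comm, this]
    simp
  | mul f' g hf' hg ih =>
    intro _ hdeg α β k h hA hB
    have htd : (g * f').totalDegree = g.totalDegree + f'.totalDegree :=
      MvPolynomial.totalDegree_mul_of_isDomain hg.ne_zero hf'
    rw [htd] at hdeg
    set α₁ := α.filter (fun i => K.onA g i)
    set α₂ := α.filter (fun i => ¬ K.onA g i)
    set β₁ := β.filter (fun j => K.onB g j)
    set β₂ := β.filter (fun j => ¬ K.onB g j)
    have ha1 : α₁ ⊆ α := Finset.filter_subset _ _
    have ha2 : α₂ ⊆ α := Finset.filter_subset _ _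
    have hb1 : β₁ ⊆ β := Finset.filter_subset _ _
    have hb2 : β₂ ⊆ β := Finset.filter_subset _ _
    obtain ⟨s₁, hs₁, hc₁, hI₁⟩ := K.irr_case p g hg (by omega) (h.mono ha1 hb1)
      (fun i hi => (Finset.mem_filter.1 hi).2) (fun j hj => (Finset.mem_filter.1 hj).2)
    obtain ⟨s₂, hs₂, hc₂, hI₂⟩ := ih hf' (by omega) (h.mono ha2 hb2)
      (fun i hi => by
        have h1 := hA i (ha2 hi)
        have h2 := (Finset.mem_filter.1 hi).2
        unfold onA at h1 h2 ⊢
        rw [map_mul] at h1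
        exact (mul_eq_zero.1 h1).resolve_left h2)
      (fun j hj => by
        have h1 := hB j (hb2 hj)
        have h2 := (Finset.mem_filter.1 hj).2
        unfold onB at h1 h2 ⊢
        rw [map_mul] at h1
        exact (mul_eq_zero.1 h1).resolve_left h2)
    have cross1 : K.I α₁ β₂ ≤ g.totalDegree * β₂.card := by
      refine (Finset.sum_le_card_nsmul _ _ g.totalDegree ?_).trans
        (by rw [smul_eq_mul, mul_comm])
      intro j hj
      exact K.smallB (h.mono ha1 hb2) g (fun i hi => (Finset.mem_filter.1 hi).2) j hj
        (Finset.mem_filter.1 hj).2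
    have cross2 : K.I α₂ β₁ ≤ g.totalDegree * α₂.card := by
      rw [I_comm]
      refine (Finset.sum_le_card_nsmul _ _ g.totalDegree ?_).trans
        (by rw [smul_eq_mul, mul_comm])
      intro i hi
      exact K.smallA (h.mono ha1 hb1).hx g (fun j hj => (Finset.mem_filter.1 hj).2) i
        (Finset.mem_filter.1 hi).2
    have hda : Disjoint α₁ α₂ := Finset.disjoint_filter_filter_not _ _ _
    have hdb : Disjoint β₁ β₂ := Finset.disjoint_filter_filter_not _ _ _
    have hua : α₁ ∪ α₂ = α := Finset.filter_union_filter_not_eq _ _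
    have hub : β₁ ∪ β₂ = β := Finset.filter_union_filter_not_eq _ _
    have hcb : β₁.card + β₂.card = β.card := by
      rw [← Finset.card_union_of_disjoint hdb, hub]
    have hca : α₁.card + α₂.card = α.card := by
      rw [← Finset.card_union_of_disjoint hda, hua]
    refine ⟨s₁ ∪ s₂, Finset.union_subset (hs₁.trans hb1) (hs₂.trans hb2), ?_, ?_⟩
    · refine (Finset.card_union_le _ _).trans ?_
      rw [htd]
      nlinarith
    · have hsd : β \ (s₁ ∪ s₂) ⊆ (β₁ \ s₁) ∪ (β₂ \ s₂) := by
        intro j hj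
        rw [Finset.mem_sdiff, Finset.mem_union, not_or] at hj
        rw [← hub, Finset.mem_union] at hj
        rw [Finset.mem_union, Finset.mem_sdiff, Finset.mem_sdiff]
        tauto
      have h1 : K.I α (β \ (s₁ ∪ s₂)) ≤ K.I (α₁ ∪ α₂) ((β₁ \ s₁) ∪ (β₂ \ s₂)) :=
        K.I_mono hua.ge hsd
      rw [K.I_split _ _ _ _ (hdb.mono Finset.sdiff_subset Finset.sdiff_subset) hda] at h1
      have h2 : K.I α₁ (β₂ \ s₂) ≤ K.I α₁ β₂ := K.I_mono subset_rfl Finset.sdiff_subset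
      have h3 : K.I α₂ (β₁ \ s₁) ≤ K.I α₂ β₁ := K.I_mono subset_rfl Finset.sdiff_subset
      rw [htd, ← hcb, ← hca]
      nlinarith [Nat.zero_le (g.totalDegree * α₁.card), Nat.zero_le (f'.totalDegree * α₁.card),
        Nat.zero_le (f'.totalDegree * β₁.card), Nat.zero_le (g.totalDegree * β₁.card),
        Nat.zero_le (g.totalDegree * β₂.card)]

end Cfg

end MPS
open Pointwise

namespace MPS

lemma averaging {ι : Type*} (w : ι → ℕ) (s : Finset ι) (M : ℕ) (hM : M ≤ s.card) :
    ∃ t ⊆ s, t.card = M ∧ M * ∑ i ∈ s, w i ≤ s.card * ∑ i ∈ t, w i := by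
  classical
  induction hM using Nat.decreasingInduction with
  | self => exact ⟨s, subset_rfl, rfl, le_rfl⟩
  | of_succ M hM ih =>
    obtain ⟨t, hts, htc, ht⟩ := ih
    have hne : t.Nonempty := by rw [← Finset.card_pos]; omega
    obtain ⟨i, hi, hmin⟩ := Finset.exists_min_image t w hne
    refine ⟨t.erase i, (Finset.erase_subset _ _).trans hts, by
      rw [Finset.card_erase_of_mem hi]; omega, ?_⟩
    have h1 : t.card * w i ≤ ∑ i ∈ t, w i := by
      have := Finset.card_nsmul_le_sum t w (w i) hmin
      simpa using this
    have h2 := Finset.add_sum_erase t w hi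
    rw [htc] at h1
    have h3 : M * ∑ i ∈ t, w i ≤ (M + 1) * ∑ x ∈ t.erase i, w x := by nlinarith
    have h4 : (M + 1) * (M * ∑ i ∈ s, w i) ≤ (M + 1) * (s.card * ∑ x ∈ t.erase i, w x) := by
      calc (M + 1) * (M * ∑ i ∈ s, w i) = M * ((M + 1) * ∑ i ∈ s, w i) := by ring
        _ ≤ M * (s.card * ∑ i ∈ t, w i) := Nat.mul_le_mul_left _ ht
        _ = s.card * (M * ∑ i ∈ t, w i) := by ring
        _ ≤ s.card * ((M + 1) * ∑ x ∈ t.erase i, w x) := Nat.mul_le_mul_left _ h3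
        _ = _ := by ring
    exact Nat.le_of_mul_le_mul_left h4 (by omega)

namespace Cfg

variable {F ι κ : Type*} [Field F] (K : Cfg F ι κ)

open scoped Classical in
lemma kst {α : Finset ι} {β : Finset κ} {k : ℕ} (h : K.Good α β k) :
    K.I α β ^ 2 ≤ α.card * (K.I α β + β.card ^ 2 * k) := by
  have h1 : K.I α β ^ 2 ≤ α.card * ∑ i ∈ α, (β.filter (fun j => K.adj i j)).card ^ 2 := by
    rw [I_comm]
    exact sq_sum_le_card_mul_sum_sq
  refine h1.trans (Nat.mul_le_mul_left _ ?_)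
  have h2 : ∑ i ∈ α, (β.filter (fun j => K.adj i j)).card ^ 2
      = ∑ j ∈ β, ∑ j' ∈ β, (α.filter (fun i => K.adj i j ∧ K.adj i j')).card := by
    have : ∀ i ∈ α, (β.filter (fun j => K.adj i j)).card ^ 2 =
        ∑ j ∈ β, ∑ j' ∈ β, if K.adj i j ∧ K.adj i j' then 1 else 0 := by
      intro i _
      rw [Finset.card_filter, sq, Finset.sum_mul_sum]
      refine Finset.sum_congr rfl fun j _ => Finset.sum_congr rfl fun j' _ => ?_
      by_cases a : K.adj i j <;> by_cases b : K.adj i j' <;> simp [a, b]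
    rw [Finset.sum_congr rfl this, Finset.sum_comm]
    refine Finset.sum_congr rfl fun j _ => ?_
    rw [Finset.sum_comm]
    refine Finset.sum_congr rfl fun j' _ => ?_
    rw [Finset.card_filter]
  rw [h2]
  have h3 : ∀ j ∈ β, ∑ j' ∈ β, (α.filter (fun i => K.adj i j ∧ K.adj i j')).card
      ≤ (α.filter (fun i => K.adj i j)).card + β.card * k := by
    intro j hj
    rw [← Finset.add_sum_erase β _ hj]
    apply add_le_add
    · exact Finset.card_le_card (fun i hi => by
        rw [Finset.mem_filter] at hi ⊢
        exact ⟨hi.1, hi.2.1⟩)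
    · refine (Finset.sum_le_card_nsmul _ _ k ?_).trans ?_
      · intro j' hj'
        rw [Finset.mem_erase] at hj'
        exact h.h2 j hj j' hj'.2 hj'.1.symm _ (Finset.filter_subset _ _)
          (fun i hi => (Finset.mem_filter.1 hi).2)
      · rw [smul_eq_mul]
        exact Nat.mul_le_mul_right _ (Finset.card_le_card (Finset.erase_subset _ _))
  refine (Finset.sum_le_sum h3).trans ?_
  rw [Finset.sum_add_distrib, Finset.sum_const, smul_eq_mul, I]
  apply le_of_eq
  ring

/-- exponent vector -/
noncomputable def expo {d : ℕ} (t : Fin d × Fin d × Fin d) : Fin 3 →₀ ℕ :=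
  Finsupp.equivFunOnFinite.symm ![(t.1 : ℕ), (t.2.1 : ℕ), (t.2.2 : ℕ)]

lemma expo_inj {d : ℕ} : Function.Injective (expo (d := d)) := by
  rintro ⟨a, b, c⟩ ⟨a', b', c'⟩ h
  have h' := Finsupp.equivFunOnFinite.symm.injective h
  have h0 := congrFun h' 0
  have h1 := congrFun h' 1
  have h2 := congrFun h' 2
  simp at h0 h1 h2
  ext <;> simp [h0, h1, h2]

/-- polynomials with small degree in each variable -/
noncomputable def mkp (F : Type*) [Field F] (d : ℕ) :
    (Fin d × Fin d × Fin d → F) →ₗ[F] MvPolynomial (Fin 3) F :=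
  ∑ t, (MvPolynomial.monomial (expo t)).comp (LinearMap.proj t)

lemma mkp_apply (d : ℕ) (c : Fin d × Fin d × Fin d → F) :
    mkp F d c = ∑ t, MvPolynomial.monomial (expo t) (c t) := by
  simp [mkp]

lemma mkp_coeff (d : ℕ) (c : Fin d × Fin d × Fin d → F) (t : Fin d × Fin d × Fin d) :
    (mkp F d c).coeff (expo t) = c t := by
  classical
  rw [mkp_apply, MvPolynomial.coeff_sum, Finset.sum_eq_single t]
  · simp
  · intro b _ hb
    rw [MvPolynomial.coeff_monomial, if_neg (fun h => hb (expo_inj h))]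
  · simp

lemma mkp_deg (d : ℕ) (hd : 0 < d) (c : Fin d × Fin d × Fin d → F) :
    (mkp F d c).totalDegree < 3 * d := by
  rw [mkp_apply]
  refine lt_of_le_of_lt (MvPolynomial.totalDegree_finsetSum_le (d := 3 * (d - 1)) ?_) (by omega)
  intro t _
  refine (MvPolynomial.totalDegree_monomial_le _ _).trans ?_
  rw [Finsupp.sum_fintype _ _ (by simp), Fin.sum_univ_three]
  simp only [expo, Finsupp.equivFunOnFinite_symm_apply_apply, Matrix.cons_val, id]
  have := t.1.2
  have := t.2.1.2
  have := t.2.2.2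
  omega

lemma exists_poly (α : Finset ι) (d : ℕ) (hd : 3 * α.card < d ^ 2) :
    ∃ f : MvPolynomial (Fin 3) F, f ≠ 0 ∧ f.totalDegree < 3 * d ∧ ∀ i ∈ α, K.onA f i := by
  classical
  have hd0 : 0 < d := by
    rcases Nat.eq_zero_or_pos d with h | h
    · rw [h] at hd; simp at hd
    · exact h
  let L : (Fin d × Fin d × Fin d → F) →ₗ[F] (α × Fin (3 * d) → F) :=
    LinearMap.pi fun q => (Polynomial.lcoeff F (q.2 : ℕ)).comp
      ((MvPolynomial.aeval (lin (K.c q.1) (K.m q.1) 0 1 (K.y q.1)) :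
        MvPolynomial (Fin 3) F →ₐ[F] Polynomial F).toLinearMap.comp (mkp F d))
  have hker : LinearMap.ker L ≠ ⊥ := by
    apply LinearMap.ker_ne_bot_of_finrank_lt
    rw [Module.finrank_fintype_fun_eq_card, Module.finrank_fintype_fun_eq_card]
    simp only [Fintype.card_prod, Fintype.card_fin, Fintype.card_coe]
    nlinarith
  obtain ⟨c, hc, hc0⟩ := Submodule.exists_mem_ne_zero_of_ne_bot hker
  refine ⟨mkp F d c, ?_, mkp_deg d hd0 c, ?_⟩
  · intro h0
    apply hc0
    funext t
    rw [← mkp_coeff d c t, h0]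
    simp
  · intro i hi
    unfold onA
    ext l
    rw [Polynomial.coeff_zero]
    by_cases hl : l < 3 * d
    · have := congrFun (LinearMap.mem_ker.1 hc) (⟨i, hi⟩, ⟨l, hl⟩)
      simpa [L] using this
    · apply Polynomial.coeff_eq_zero_of_natDegree_lt
      have h1 := natDegree_aeval_le (mkp F d c) _ (lin_deg (K.c i) (K.m i) 0 1 (K.y i))
      have h2 := mkp_deg d hd0 c
      omega

lemma incidence_bound [Infinite F] (p : ℕ) [CharP F p] {α : Finset ι} {β : Finset κ} {k : ℕ}
    (h : K.Good α β k) (d : ℕ) (hd : 3 * α.card < d ^ 2) (hp : 3 * d ≤ p) :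
    ∃ J : ℕ, K.I α β ≤ 3 * d * α.card + (18 * d + k) * β.card + J ∧
      J ^ 2 ≤ α.card * (J + (72 * d ^ 2) ^ 2 * k) := by
  classical
  obtain ⟨f, hf0, hfd, hfA⟩ := K.exists_poly α d hd
  have hb0 : β.filter (fun j => K.onB f j) ⊆ β := Finset.filter_subset _ _
  obtain ⟨b, hb, hbc, hbI⟩ := K.surface_case p f hf0 (by omega) (h.mono subset_rfl hb0) hfA
    (fun j hj => (Finset.mem_filter.1 hj).2)
  refine ⟨K.I α b, ?_, ?_⟩
  · have e1 : K.I α β ≤ K.I α (β.filter (fun j => ¬ K.onB f j)) +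
        (K.I α (β.filter (fun j => K.onB f j) \ b) + K.I α b) := by
      have hu : ∀ s t : Finset κ, K.I α (s ∪ t) ≤ K.I α s + K.I α t := by
        intro s t
        unfold I
        rw [← Finset.sum_union_inter]
        exact Nat.le_add_right _ _
      refine (K.I_mono subset_rfl ?_).trans ((hu _ _).trans (Nat.add_le_add_left (hu _ _) _))
      intro j hj
      simp only [Finset.mem_union, Finset.mem_filter, Finset.mem_sdiff]
      tauto
    have e2 : K.I α (β.filter (fun j => ¬ K.onB f j)) ≤ (3 * d) * β.card := by
      refine (K.I_le_of α _ (3 * d) ?_).trans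
        (Nat.mul_le_mul_left _ (Finset.card_le_card (Finset.filter_subset _ _)))
      intro j hj s hs hadj
      rw [Finset.mem_filter] at hj
      have h1 := K.smallB h f hfA j hj.1 hj.2
      have h2 : s ⊆ α.filter (fun i => K.adj i j) := fun i hi =>
        Finset.mem_filter.2 ⟨hs hi, hadj i hi⟩
      have h3 := Finset.card_le_card h2
      omega
    have e3 : f.totalDegree * α.card +
        (5 * f.totalDegree + k) * (β.filter (fun j => K.onB f j)).card
        ≤ 3 * d * α.card + (15 * d + k) * β.card := by
      have := Finset.card_le_card hb0
      have h5 : 5 * f.totalDegree + k ≤ 15 * d + k := by omega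
      exact add_le_add (Nat.mul_le_mul_right _ hfd.le) (Nat.mul_le_mul h5 this)
    nlinarith
  · refine (K.kst (h.mono subset_rfl (hb.trans hb0))).trans ?_
    gcongr
    refine hbc.trans ?_
    have : f.totalDegree ^ 2 ≤ (3 * d) ^ 2 := by gcongr
    nlinarith

end Cfg

end MPS
open Pointwise

namespace MPS

/-- The concrete configuration. -/
noncomputable def conf (p : ℕ) [Fact p.Prime] {F : Type*} [Field F] (ρ : ZMod p →+* F) (s τ : F) :
    Cfg F (ZMod p × ZMod p × ZMod p) (ZMod p × ZMod p × ZMod p) where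
  y := fun i => (ρ i.2.2 + s * ρ (i.2.1 / i.1)) / (1 + τ * ρ (i.2.1 / i.1))
  m := fun i => ρ (i.2.1 / i.1) / (1 + τ * ρ (i.2.1 / i.1))
  c := fun i => ρ i.2.1 / (1 + τ * ρ (i.2.1 / i.1))
  x := fun i => ρ i.2.2 + s * ρ (i.2.1 / i.1) + τ * ρ i.2.1
  n := fun i => ρ (i.2.1 / i.1)
  d := fun i => ρ i.2.1

lemma den_ne (p : ℕ) [Fact p.Prime] {F : Type*} [Field F] (ρ : ZMod p →+* F) (s τ : F)
    (hs : ∀ a b c : ZMod p, ρ a + s * ρ b + τ * ρ c = 0 → a = 0 ∧ b = 0 ∧ c = 0)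
    (m : ZMod p) : 1 + τ * ρ m ≠ 0 := by
  intro h
  have := (hs 1 0 m (by simpa using h)).1
  exact one_ne_zero this

lemma conf_adj (p : ℕ) [Fact p.Prime] {F : Type*} [Field F] (ρ : ZMod p →+* F) (s τ : F)
    (hs : ∀ a b c : ZMod p, ρ a + s * ρ b + τ * ρ c = 0 → a = 0 ∧ b = 0 ∧ c = 0)
    (b v q b' v' q' : ZMod p) :
    (conf p ρ s τ).adj (b, v, q) (b', v', q') ↔ v / b * q' + v = v' / b' * q + v' := by
  have hne := den_ne p ρ s τ hs (v / b)
  simp only [Cfg.adj, conf]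
  rw [div_mul_eq_mul_div, ← add_div, div_eq_iff hne, add_mul, mul_assoc,
    div_mul_cancel₀ _ hne]
  constructor
  · intro h
    apply ρ.injective
    simp only [map_add, map_mul]
    linear_combination h
  · intro h
    have h' := congrArg ρ h
    simp only [map_add, map_mul] at h'
    linear_combination h'

lemma conf_y (p : ℕ) [Fact p.Prime] {F : Type*} [Field F] (ρ : ZMod p →+* F) (s τ : F)
    (hs : ∀ a b c : ZMod p, ρ a + s * ρ b + τ * ρ c = 0 → a = 0 ∧ b = 0 ∧ c = 0)
    (b v q b' v' q' : ZMod p)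
    (h : (conf p ρ s τ).y (b, v, q) = (conf p ρ s τ).y (b', v', q')) :
    q = q' ∧ v / b = v' / b' := by
  simp only [conf] at h
  rw [div_eq_div_iff (den_ne p ρ s τ hs _) (den_ne p ρ s τ hs _)] at h
  have := hs (q - q') (v / b - v' / b') (q * (v' / b') - q' * (v / b)) (by
    simp only [map_sub, map_mul]
    linear_combination h)
  exact ⟨sub_eq_zero.1 this.1, sub_eq_zero.1 this.2.1⟩

lemma conf_x (p : ℕ) [Fact p.Prime] {F : Type*} [Field F] (ρ : ZMod p →+* F) (s τ : F)
    (hs : ∀ a b c : ZMod p, ρ a + s * ρ b + τ * ρ c = 0 → a = 0 ∧ b = 0 ∧ c = 0)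
    (b v q b' v' q' : ZMod p)
    (h : (conf p ρ s τ).x (b, v, q) = (conf p ρ s τ).x (b', v', q')) :
    q = q' ∧ v / b = v' / b' ∧ v = v' := by
  simp only [conf] at h
  have := hs (q - q') (v / b - v' / b') (v - v') (by
    simp only [map_sub]
    linear_combination h)
  exact ⟨sub_eq_zero.1 this.1, sub_eq_zero.1 this.2.1, sub_eq_zero.1 this.2.2⟩

lemma div_cancel_eq (p : ℕ) [Fact p.Prime] {b b' v : ZMod p} (hv : v ≠ 0) (hb : b ≠ 0) (hb' : b' ≠ 0)
    (h : v / b = v / b') : b = b' := by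
  rw [div_eq_div_iff hb hb'] at h
  exact (mul_left_cancel₀ hv h).symm

lemma conf_good (p : ℕ) [Fact p.Prime] {F : Type*} [Field F] (ρ : ZMod p →+* F) (s τ : F)
    (hs : ∀ a b c : ZMod p, ρ a + s * ρ b + τ * ρ c = 0 → a = 0 ∧ b = 0 ∧ c = 0)
    (B : Finset (ZMod p)) (h0 : (0 : ZMod p) ∉ B) (h1 : (-1 : ZMod p) ∉ B) :
    (conf p ρ s τ).Good (B ×ˢ (B + {1}) ×ˢ (B * B)) (B ×ˢ (B + {1}) ×ˢ (B * B))
      (B * B).card := by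
  classical
  have hB : ∀ b ∈ B, b ≠ 0 := fun b hb h => h0 (h ▸ hb)
  have hV : ∀ v ∈ B + {1}, v ≠ 0 := by
    intro v hv h
    rw [Finset.mem_add] at hv
    obtain ⟨b, hb, c, hc, rfl⟩ := hv
    rw [Finset.mem_singleton] at hc
    rw [hc] at h
    rw [eq_neg_of_add_eq_zero_left h] at hb
    exact h1 hb
  have hcV : (B + {1}).card = B.card := by
    rw [Finset.add_singleton]
    exact Finset.card_image_of_injective _ (add_left_injective 1)
  have hcQ : B.card ≤ (B * B).card := by
    rcases B.eq_empty_or_nonempty with h | h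
    · simp [h]
    · obtain ⟨b, hb⟩ := h
      rw [← Finset.card_image_of_injective B (mul_right_injective₀ (hB b hb))]
      apply Finset.card_le_card
      intro z hz
      obtain ⟨a, ha, rfl⟩ := Finset.mem_image.1 hz
      exact Finset.mul_mem_mul hb ha
  refine ⟨?_, ?_, ?_⟩
  · rintro ⟨b, v, q⟩ hi ⟨b', v', q'⟩ hi' h
    simp only [Finset.mem_coe, Finset.mem_product] at hi hi'
    obtain ⟨e1, e2, rfl⟩ := conf_x p ρ s τ hs _ _ _ _ _ _ h
    rw [e1, div_cancel_eq p (hV _ hi.2.1) (hB _ hi.1) (hB _ hi'.1) e2]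
  · rintro ⟨b₁, v₁, q₁⟩ hj ⟨b, v, q⟩ hi ⟨b', v', q'⟩ hi' a a' h
    simp only [Finset.mem_product] at hi hi'
    rw [conf_adj p ρ s τ hs] at a a'
    obtain ⟨rfl, e2⟩ := conf_y p ρ s τ hs _ _ _ _ _ _ h
    rw [← a', e2] at a
    have e3 := add_left_cancel a
    subst e3
    rw [div_cancel_eq p (hV _ hi.2.1) (hB _ hi.1) (hB _ hi'.1) e2]
  · rintro ⟨b₁, v₁, q₁⟩ hj ⟨b₂, v₂, q₂⟩ hj' hne t ht hadj
    simp only [Finset.mem_product] at hj hj'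
    have key : ∀ b v q, (b, v, q) ∈ t → b ∈ B ∧ v ∈ B + {1} ∧ q ∈ B * B ∧
        v / b * q₁ + v = v₁ / b₁ * q + v₁ ∧ v / b * q₂ + v = v₂ / b₂ * q + v₂ := by
      intro b v q hm
      have e1 := ht hm
      have e2 := hadj _ hm
      rw [conf_adj p ρ s τ hs, conf_adj p ρ s τ hs] at e2
      simp only [Finset.mem_product] at e1
      exact ⟨e1.1, e1.2.1, e1.2.2, e2.1, e2.2⟩
    by_cases hq : q₁ = q₂
    · subst hq
      have hm : v₁ / b₁ - v₂ / b₂ ≠ 0 ∨ t = ∅ := by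
        by_cases hm : v₁ / b₁ - v₂ / b₂ = 0
        · right
          rw [Finset.eq_empty_iff_forall_notMem]
          rintro ⟨b, v, q⟩ hmem
          obtain ⟨-, -, -, k1, k2⟩ := key b v q hmem
          have e1 : v₁ = v₂ := by linear_combination k2 - k1 - q * hm
          subst e1
          apply hne
          rw [div_cancel_eq p (hV _ hj.2.1) (hB _ hj.1) (hB _ hj'.1) (sub_eq_zero.1 hm)]
        · exact Or.inl hm
      rcases hm with hm | hm
      swap
      · simp [hm]
      obtain ⟨q₀, hq₀⟩ : ∃ q₀, q₀ = (v₂ - v₁) / (v₁ / b₁ - v₂ / b₂) := ⟨_, rfl⟩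
      have hqq : ∀ b v q, (b, v, q) ∈ t → q = q₀ := by
        intro b v q hmem
        obtain ⟨-, -, -, k1, k2⟩ := key b v q hmem
        rw [hq₀, eq_div_iff hm]
        linear_combination k2 - k1
      by_cases hR : v₁ / b₁ * q₀ + v₁ = 0
      · refine le_trans ?_ hcQ
        rw [← hcV]
        apply Finset.card_le_card_of_injOn (fun i => i.2.1)
        · rintro ⟨b, v, q⟩ hmem
          exact (key b v q hmem).2.1
        · rintro ⟨b, v, q⟩ hmem ⟨b', v', q'⟩ hmem' h
          simp only at h
          subst h
          have f1 := hqq _ _ _ hmem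
          have f2 := hqq _ _ _ hmem'
          obtain ⟨l1, l2, -, k1, -⟩ := key b v q hmem
          obtain ⟨l1', l2', -, k1', -⟩ := key b' v q' hmem'
          rw [f1, hR] at k1
          rw [f2, hR] at k1'
          have hbb : ∀ c ∈ B, v / c * q₁ + v = 0 → c = - q₁ := by
            intro c hc h
            have hc0 := hB c hc
            have hv0 := hV v l2
            field_simp at h
            have h3 : q₁ + c = 0 := by
              rcases mul_eq_zero.1 (show v * (q₁ + c) = 0 by linear_combination h) with h3 | h3
              · exact absurd h3 hv0
              · exact h3
            linear_combination h3
          rw [hbb b l1 k1, hbb b' l1' k1', f1, f2]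
      · refine le_trans ?_ hcQ
        apply Finset.card_le_card_of_injOn (fun i => i.1)
        · rintro ⟨b, v, q⟩ hmem
          exact (key b v q hmem).1
        · rintro ⟨b, v, q⟩ hmem ⟨b', v', q'⟩ hmem' h
          simp only at h
          subst h
          have f1 := hqq _ _ _ hmem
          have f2 := hqq _ _ _ hmem'
          obtain ⟨l1, l2, -, k1, -⟩ := key b v q hmem
          obtain ⟨l1', l2', -, k1', -⟩ := key b v' q' hmem'
          rw [f1] at k1
          rw [f2] at k1'
          have hne' : q₁ / b + 1 ≠ 0 := by
            intro hz
            apply hR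
            rw [← k1]
            linear_combination v * hz
          have e3 : v * (q₁ / b + 1) = v' * (q₁ / b + 1) := by
            linear_combination k1 - k1'
          rw [mul_right_cancel₀ hne' e3, f1, f2]
    · apply Finset.card_le_card_of_injOn (fun i => i.2.2)
      · rintro ⟨b, v, q⟩ hmem
        exact (key b v q hmem).2.2.1
      · rintro ⟨b, v, q⟩ hmem ⟨b', v', q'⟩ hmem' h
        simp only at h
        subst h
        obtain ⟨l1, l2, -, k1, k2⟩ := key b v q hmem
        obtain ⟨l1', l2', -, k1', k2'⟩ := key b' v' q hmem'
        have e1 : v / b * (q₁ - q₂) = v' / b' * (q₁ - q₂) := by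
          linear_combination k1 - k2 - k1' + k2'
        have e2 := mul_right_cancel₀ (sub_ne_zero.2 hq) e1
        have e3 : v = v' := by linear_combination k1 - k1' - q₁ * e2
        subst e3
        rw [div_cancel_eq p (hV _ l2) (hB _ l1) (hB _ l1') e2]

lemma conf_lower (p : ℕ) [Fact p.Prime] {F : Type*} [Field F] (ρ : ZMod p →+* F) (s τ : F)
    (hs : ∀ a b c : ZMod p, ρ a + s * ρ b + τ * ρ c = 0 → a = 0 ∧ b = 0 ∧ c = 0)
    (B : Finset (ZMod p)) (h0 : (0 : ZMod p) ∉ B) :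
    B.card ^ 6 ≤ ((B + {1}) * (B + {1})).card *
      (conf p ρ s τ).I (B ×ˢ (B + {1}) ×ˢ (B * B)) (B ×ˢ (B + {1}) ×ˢ (B * B)) := by
  classical
  have hB : ∀ b ∈ B, b ≠ 0 := fun b hb h => h0 (h ▸ hb)
  have hcV : (B + {1}).card = B.card := by
    rw [Finset.add_singleton]
    exact Finset.card_image_of_injective _ (add_left_injective 1)
  set S := B ×ˢ (B + {1}) ×ˢ B with hS
  set W := (B + {1}) * (B + {1}) with hW
  let f : ZMod p × ZMod p × ZMod p → ZMod p := fun t => t.2.1 * (t.2.2 + 1)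
  have hf : ∀ t ∈ S, f t ∈ W := by
    rintro ⟨b, v, a⟩ ht
    simp only [hS, Finset.mem_product] at ht
    exact Finset.mul_mem_mul ht.2.1 (Finset.add_mem_add ht.2.2 (Finset.mem_singleton_self 1))
  have hSc : S.card = B.card ^ 3 := by
    rw [hS, Finset.card_product, Finset.card_product, hcV]
    ring
  set P := (S ×ˢ S).filter (fun t => f t.1 = f t.2) with hP
  have hPc : P.card = ∑ w ∈ W, (S.filter (fun t => f t = w)).card ^ 2 := by
    rw [Finset.card_eq_sum_card_fiberwise (f := fun t => f t.1) (t := W)]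
    · refine Finset.sum_congr rfl fun w _ => ?_
      rw [sq, ← Finset.card_product]
      congr 1
      ext ⟨t, t'⟩
      simp only [hP, Finset.mem_filter, Finset.mem_product]
      constructor
      · rintro ⟨⟨⟨a, b⟩, c⟩, d⟩
        exact ⟨⟨a, d⟩, ⟨b, c ▸ d⟩⟩
      · rintro ⟨⟨a, d⟩, ⟨b, e⟩⟩
        exact ⟨⟨⟨a, b⟩, by rw [d, e]⟩, d⟩
    · intro t ht
      simp only [hP, Finset.mem_coe, Finset.mem_filter, Finset.mem_product] at ht
      exact hf _ ht.1.1
  have h1 : B.card ^ 6 ≤ W.card * P.card := by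
    rw [hPc]
    calc B.card ^ 6 = S.card ^ 2 := by rw [hSc]; ring
      _ = (∑ w ∈ W, (S.filter (fun t => f t = w)).card) ^ 2 := by
          rw [Finset.card_eq_sum_card_fiberwise (f := f) (t := W) hf]
      _ ≤ _ := sq_sum_le_card_mul_sum_sq
  refine h1.trans (Nat.mul_le_mul_left _ ?_)
  set α := B ×ˢ (B + {1}) ×ˢ (B * B) with hα
  have hI : (conf p ρ s τ).I α α =
      ((α ×ˢ α).filter (fun t => (conf p ρ s τ).adj t.1 t.2)).card := by
    rw [Finset.card_filter, Finset.sum_product_right, Cfg.I]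
    refine Finset.sum_congr rfl fun j _ => ?_
    rw [Finset.card_filter]
  rw [hI]
  apply Finset.card_le_card_of_injOn
    (fun t => ((t.1.1, t.1.2.1, t.2.2.2 * t.2.1), (t.2.1, t.2.2.1, t.1.2.2 * t.1.1)))
  · rintro ⟨⟨b, v, a⟩, ⟨b', v', a'⟩⟩ ht
    simp only [hP, hS, f, Finset.mem_coe, Finset.mem_filter, Finset.mem_product] at ht
    simp only [hα, Finset.mem_coe, Finset.mem_filter, Finset.mem_product]
    refine ⟨⟨⟨ht.1.1.1, ht.1.1.2.1, Finset.mul_mem_mul ht.1.2.2.2 ht.1.2.1⟩,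
      ⟨ht.1.2.1, ht.1.2.2.1, Finset.mul_mem_mul ht.1.1.2.2 ht.1.1.1⟩⟩, ?_⟩
    rw [conf_adj p ρ s τ hs]
    have hb := hB b ht.1.1.1
    have hb' := hB b' ht.1.2.1
    have e1 : v / b * (a * b) = v * a := by field_simp
    have e2 : v' / b' * (a' * b') = v' * a' := by field_simp
    rw [e1, e2]
    linear_combination ht.2
  · rintro ⟨⟨b, v, a⟩, ⟨b', v', a'⟩⟩ ht ⟨⟨b₁, v₁, a₁⟩, ⟨b₁', v₁', a₁'⟩⟩ ht₁ h
    simp only [hP, hS, Finset.mem_coe, Finset.mem_filter, Finset.mem_product] at ht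
    simp only [Prod.mk.injEq] at h
    obtain ⟨⟨rfl, rfl, e1⟩, ⟨rfl, rfl, e2⟩⟩ := h
    rw [mul_right_cancel₀ (hB _ ht.1.2.1) e1, mul_right_cancel₀ (hB _ ht.1.1.1) e2]

lemma exists_field (p : ℕ) [Fact p.Prime] : ∃ (s τ : FractionRing (Polynomial (ZMod p))),
    ∀ a b c : ZMod p, algebraMap (ZMod p) (FractionRing (Polynomial (ZMod p))) a +
      s * algebraMap _ _ b + τ * algebraMap _ _ c = 0 → a = 0 ∧ b = 0 ∧ c = 0 := by
  refine ⟨algebraMap (Polynomial (ZMod p)) _ Polynomial.X,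
    algebraMap (Polynomial (ZMod p)) _ (Polynomial.X ^ 2), ?_⟩
  intro a b c h
  have hinj := IsFractionRing.injective (Polynomial (ZMod p))
    (FractionRing (Polynomial (ZMod p)))
  have h2 : (Polynomial.C a + Polynomial.X * Polynomial.C b : Polynomial (ZMod p)) +
      Polynomial.X ^ 2 * Polynomial.C c = 0 := by
    apply hinj
    rw [map_zero, ← h]
    simp only [map_add, map_mul, IsScalarTower.algebraMap_apply (ZMod p) (Polynomial (ZMod p))
      (FractionRing (Polynomial (ZMod p))), Polynomial.algebraMap_eq]
  have e0 := congrArg (fun q => Polynomial.coeff q 0) h2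
  have e1 := congrArg (fun q => Polynomial.coeff q 1) h2
  have e2 := congrArg (fun q => Polynomial.coeff q 2) h2
  simp [Polynomial.coeff_C, Polynomial.coeff_X_mul, Polynomial.coeff_X_pow_mul',
    Polynomial.coeff_X, Polynomial.coeff_X_pow] at e0 e1 e2
  exact ⟨e0, e1, e2⟩

lemma numbers (p : ℕ) (hp : p.Prime) (B : Finset (ZMod p)) (h0 : (0 : ZMod p) ∉ B)
    (h1 : (-1 : ZMod p) ∉ B) (d M : ℕ) (hd : 3 * M < d ^ 2) (hdp : 3 * d ≤ p)
    (hM : M ≤ B.card ^ 2 * (B * B).card) :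
    ∃ T S J : ℕ, B.card ^ 6 ≤ ((B + {1}) * (B + {1})).card * T ∧
      M * T ≤ (B.card ^ 2 * (B * B).card) * S ∧
      S ≤ 3 * d * M + (18 * d + (B * B).card) * (B.card ^ 2 * (B * B).card) + J ∧
      J ^ 2 ≤ M * (J + (72 * d ^ 2) ^ 2 * (B * B).card) := by
  classical
  have : Fact p.Prime := ⟨hp⟩
  obtain ⟨s, τ, hs⟩ := exists_field p
  have : CharP (FractionRing (Polynomial (ZMod p))) p :=
    charP_of_injective_algebraMap
      (IsFractionRing.injective (Polynomial (ZMod p)) (FractionRing (Polynomial (ZMod p)))) p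
  have : Infinite (FractionRing (Polynomial (ZMod p))) :=
    Infinite.of_injective _ (IsFractionRing.injective (Polynomial (ZMod p))
      (FractionRing (Polynomial (ZMod p))))
  set K := conf p (algebraMap (ZMod p) (FractionRing (Polynomial (ZMod p)))) s τ with hK
  set α := B ×ˢ (B + {1}) ×ˢ (B * B) with hα
  have hcV : (B + {1}).card = B.card := by
    rw [Finset.add_singleton]
    exact Finset.card_image_of_injective _ (add_left_injective 1)
  have hαc : α.card = B.card ^ 2 * (B * B).card := by
    rw [hα, Finset.card_product, Finset.card_product, hcV]
    ring
  have hgood : K.Good α α (B * B).card := conf_good p _ s τ hs B h0 h1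
  have hlow := conf_lower p _ s τ hs B h0
  obtain ⟨t, ht, htc, hav⟩ := averaging
    (fun i => (α.filter (fun j => K.adj i j)).card) α M (by rw [hαc]; exact hM)
  have e1 : K.I α α = ∑ i ∈ α, (α.filter (fun j => K.adj i j)).card := by
    rw [Cfg.I_comm]
  have e2 : K.I t α = ∑ i ∈ t, (α.filter (fun j => K.adj i j)).card := by
    rw [Cfg.I_comm]
  obtain ⟨J, hJ1, hJ2⟩ := K.incidence_bound p (hgood.mono ht subset_rfl) d
    (by rw [htc]; exact hd) hdp
  rw [htc, hαc] at hJ1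
  rw [htc] at hJ2
  refine ⟨K.I α α, K.I t α, J, hlow, ?_, hJ1, hJ2⟩
  rw [e1, e2, ← hαc]
  exact hav

end MPS
open Pointwise

namespace MPS

set_option maxHeartbeats 2000000 in
lemma arith (N X q w d M T S J : ℝ) (hN : 0 < N) (hNX : N ≤ X) (hq0 : 0 ≤ q) (hqX : q ≤ X)
    (hwX : w ≤ X) (hT0 : 0 ≤ T) (hS0 : 0 ≤ S)
    (hbig : 10 ^ 12 * X ^ 11 < N ^ 12) (hd0 : 0 ≤ d)
    (hd1 : 400 * X ^ 3 ≤ d * N ^ 2) (hd2 : d * N ^ 2 ≤ 800 * X ^ 3)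
    (hM : d ^ 2 ≤ 5 * M) (hM2 : 4 * M ≤ d ^ 2)
    (h1 : N ^ 6 ≤ w * T) (h2 : M * T ≤ N ^ 2 * q * S)
    (h3 : S ≤ 3 * d * M + (18 * d + q) * (N ^ 2 * q) + J)
    (hJ0 : 0 ≤ J) (hJ : J ^ 2 ≤ M * (J + (72 * d ^ 2) ^ 2 * q)) : False := by
  have hX : 0 < X := hN.trans_le hNX
  have hd : 0 < d := by
    by_contra hd
    have : d = 0 := le_antisymm (not_lt.1 hd) hd0
    rw [this] at hd1
    have : 0 < X ^ 3 := by positivity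
    linarith
  have hMpos : 0 < M := by nlinarith
  have hNbig : 10 ^ 12 < N := by
    have e1 : N ^ 11 ≤ X ^ 11 := by gcongr
    have e2 : 10 ^ 12 * N ^ 11 < N * N ^ 11 := by
      calc 10 ^ 12 * N ^ 11 ≤ 10 ^ 12 * X ^ 11 := by gcongr
        _ < N ^ 12 := hbig
        _ = N * N ^ 11 := by ring
    exact lt_of_mul_lt_mul_right e2 (by positivity)
  -- main inequality
  have hmain : M * N ^ 4 ≤ X ^ 2 * S := by
    have e1 : M * N ^ 6 ≤ N ^ 2 * (X ^ 2 * S) := by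
      calc M * N ^ 6 ≤ M * (w * T) := by gcongr
        _ ≤ M * (X * T) := by gcongr
        _ = X * (M * T) := by ring
        _ ≤ X * (N ^ 2 * q * S) := by gcongr
        _ ≤ X * (N ^ 2 * X * S) := by gcongr
        _ = N ^ 2 * (X ^ 2 * S) := by ring
    have e2 : N ^ 2 * (M * N ^ 4) ≤ N ^ 2 * (X ^ 2 * S) := by
      calc N ^ 2 * (M * N ^ 4) = M * N ^ 6 := by ring
        _ ≤ _ := e1
    exact le_of_mul_le_mul_left e2 (by positivity)
  have hS : S ≤ 3 * d * M + 18 * d * (N ^ 2 * X) + N ^ 2 * X ^ 2 + J := by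
    calc S ≤ 3 * d * M + (18 * d + q) * (N ^ 2 * q) + J := h3
      _ ≤ 3 * d * M + (18 * d + X) * (N ^ 2 * X) + J := by gcongr
      _ = _ := by ring
  have hmain2 : M * N ^ 4 ≤ X ^ 2 * (3 * d * M) + X ^ 2 * (18 * d * (N ^ 2 * X)) +
      X ^ 2 * (N ^ 2 * X ^ 2) + X ^ 2 * J := by
    calc M * N ^ 4 ≤ X ^ 2 * S := hmain
      _ ≤ X ^ 2 * (3 * d * M + 18 * d * (N ^ 2 * X) + N ^ 2 * X ^ 2 + J) := by gcongr
      _ = _ := by ring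
  have hX10 : X ^ 10 < N ^ 11 := by
    have e1 : N * X ^ 10 < N * N ^ 11 := by
      calc N * X ^ 10 ≤ X * X ^ 10 := by gcongr
        _ = 1 * X ^ 11 := by ring
        _ ≤ 10 ^ 12 * X ^ 11 := by gcongr; norm_num
        _ < N ^ 12 := hbig
        _ = N * N ^ 11 := by ring
    exact lt_of_mul_lt_mul_left e1 hN.le
  have hX5 : 10 ^ 6 * X ^ 5 < N ^ 6 := by
    have e1 : (10 ^ 6 * X ^ 5) ^ 2 < (N ^ 6) ^ 2 := by
      calc (10 ^ 6 * X ^ 5) ^ 2 = 10 ^ 12 * X ^ 10 := by ring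
        _ < 10 ^ 12 * N ^ 11 := by gcongr
        _ ≤ N * N ^ 11 := by gcongr
        _ = (N ^ 6) ^ 2 := by ring
    exact lt_of_pow_lt_pow_left₀ 2 (by positivity) e1
  -- (a)
  have ha : X ^ 2 * (3 * d * M) < M * N ^ 4 / 4 := by
    have e1 : 12 * d * X ^ 2 < N ^ 4 := by
      have : N ^ 2 * (12 * d * X ^ 2) < N ^ 2 * N ^ 4 := by
        calc N ^ 2 * (12 * d * X ^ 2) = 12 * X ^ 2 * (d * N ^ 2) := by ring
          _ ≤ 12 * X ^ 2 * (800 * X ^ 3) := by gcongr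
          _ = 9600 * X ^ 5 := by ring
          _ ≤ 10 ^ 6 * X ^ 5 := by gcongr; norm_num
          _ < N ^ 6 := hX5
          _ = N ^ 2 * N ^ 4 := by ring
      exact lt_of_mul_lt_mul_left this (by positivity)
    have : M * (12 * d * X ^ 2) < M * N ^ 4 := by gcongr
    linarith
  -- (b)
  have hb : X ^ 2 * (18 * d * (N ^ 2 * X)) < M * N ^ 4 / 4 := by
    have e1 : 72 * (d * X ^ 3) < M * N ^ 2 := by
      have : d * (400 * X ^ 3) ≤ 5 * M * N ^ 2 := by
        calc d * (400 * X ^ 3) ≤ d * (d * N ^ 2) := by gcongr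
          _ = d ^ 2 * N ^ 2 := by ring
          _ ≤ 5 * M * N ^ 2 := by gcongr
      have h0 : 0 < d * X ^ 3 := by positivity
      linarith
    have : N ^ 2 * (72 * (d * X ^ 3)) < N ^ 2 * (M * N ^ 2) := by gcongr
    linarith
  -- (c)
  have hc : X ^ 2 * (N ^ 2 * X ^ 2) < M * N ^ 4 / 4 := by
    have e1 : 400 * X ^ 2 ≤ d * N := by
      have : X * (400 * X ^ 2) ≤ X * (d * N) := by
        calc X * (400 * X ^ 2) = 400 * X ^ 3 := by ring
          _ ≤ d * N ^ 2 := hd1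
          _ = N * (d * N) := by ring
          _ ≤ X * (d * N) := by gcongr
      exact le_of_mul_le_mul_left this hX
    have e2 : (400 * X ^ 2) ^ 2 ≤ (d * N) ^ 2 := by gcongr
    have e3 : (d * N) ^ 2 ≤ 5 * M * N ^ 2 := by
      calc (d * N) ^ 2 = d ^ 2 * N ^ 2 := by ring
        _ ≤ _ := by gcongr
    have h0 : 0 < X ^ 4 := by positivity
    have e4 : 4 * X ^ 4 < M * N ^ 2 := by nlinarith
    have : N ^ 2 * (4 * X ^ 4) < N ^ 2 * (M * N ^ 2) := by gcongr
    linarith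
  -- (d)
  have hdd : X ^ 2 * J < M * N ^ 4 / 4 := by
    by_contra hcon
    have hcon : M * N ^ 4 ≤ 4 * X ^ 2 * J := by linarith
    rcases le_or_gt J (2 * M) with hJM | hJM
    · have e1 : M * N ^ 4 ≤ M * (8 * X ^ 2) := by
        calc M * N ^ 4 ≤ 4 * X ^ 2 * J := hcon
          _ ≤ 4 * X ^ 2 * (2 * M) := by gcongr
          _ = _ := by ring
      have e2 := le_of_mul_le_mul_left e1 hMpos
      have e3 : X ^ 3 * N ^ 4 ≤ 8 * X ^ 5 := by
        calc X ^ 3 * N ^ 4 ≤ X ^ 3 * (8 * X ^ 2) := by gcongr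
          _ = _ := by ring
      have e4 : N ^ 3 * N ^ 4 ≤ X ^ 3 * N ^ 4 := by gcongr
      have e5 : N ^ 6 * 10 ^ 12 ≤ N ^ 6 * N := by gcongr
      have h0 : 0 < N ^ 6 := by positivity
      have e6 : N ^ 3 * N ^ 4 = N ^ 6 * N := by ring
      have e7 : 0 < X ^ 5 := by positivity
      linarith
    · have e1 : J ^ 2 ≤ 10368 * M * d ^ 4 * X := by
        have : M * J ≤ J ^ 2 / 2 := by nlinarith
        have e2 : M * ((72 * d ^ 2) ^ 2 * q) ≤ M * ((72 * d ^ 2) ^ 2 * X) := by gcongr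
        nlinarith
      have e2 : (M * N ^ 4) ^ 2 ≤ (4 * X ^ 2 * J) ^ 2 := by gcongr
      have e3 : M * (M * N ^ 8) ≤ M * (165888 * d ^ 4 * X ^ 5) := by
        calc M * (M * N ^ 8) = (M * N ^ 4) ^ 2 := by ring
          _ ≤ (4 * X ^ 2 * J) ^ 2 := e2
          _ = 16 * X ^ 4 * J ^ 2 := by ring
          _ ≤ 16 * X ^ 4 * (10368 * M * d ^ 4 * X) := by gcongr
          _ = _ := by ring
      have e4 := le_of_mul_le_mul_left e3 hMpos
      have e5 : d ^ 2 * N ^ 8 ≤ d ^ 2 * (829440 * d ^ 2 * X ^ 5) := by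
        calc d ^ 2 * N ^ 8 ≤ 5 * M * N ^ 8 := by gcongr
          _ = 5 * (M * N ^ 8) := by ring
          _ ≤ 5 * (165888 * d ^ 4 * X ^ 5) := by gcongr
          _ = _ := by ring
      have e6 := le_of_mul_le_mul_left e5 (by positivity)
      have e7 : N ^ 12 ≤ 829440 * 640000 * X ^ 11 := by
        calc N ^ 12 = N ^ 4 * N ^ 8 := by ring
          _ ≤ N ^ 4 * (829440 * d ^ 2 * X ^ 5) := by gcongr
          _ = 829440 * (d * N ^ 2) ^ 2 * X ^ 5 := by ring
          _ ≤ 829440 * (800 * X ^ 3) ^ 2 * X ^ 5 := by gcongr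
          _ = _ := by ring
      have h0 : 0 < X ^ 11 := by positivity
      linarith
  linarith

lemma power_bound (p : ℕ) (hp : p.Prime) (B : Finset (ZMod p)) (h0 : (0 : ZMod p) ∉ B)
    (h1 : (-1 : ZMod p) ∉ B) (hBp : B.card ^ 2 ≤ p) (X : ℕ) (hq : (B * B).card ≤ X)
    (hw : ((B + {1}) * (B + {1})).card ≤ X) : B.card ^ 12 ≤ 10 ^ 12 * X ^ 11 := by
  by_contra hcon
  push Not at hcon
  have : Fact p.Prime := ⟨hp⟩
  obtain ⟨N, hN⟩ : ∃ N, N = B.card := ⟨_, rfl⟩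
  rw [← hN] at hcon hBp
  have hNpos : 0 < N := by
    rcases Nat.eq_zero_or_pos N with h | h
    · rw [h] at hcon; simp at hcon
    · exact h
  have hNq : N ≤ (B * B).card := by
    obtain ⟨b, hb⟩ := Finset.card_pos.1 (hN ▸ hNpos)
    have hb0 : b ≠ 0 := fun h => h0 (h ▸ hb)
    rw [hN, ← Finset.card_image_of_injective B (mul_right_injective₀ hb0)]
    apply Finset.card_le_card
    intro z hz
    obtain ⟨a, ha, rfl⟩ := Finset.mem_image.1 hz
    exact Finset.mul_mem_mul hb ha
  have hNX : N ≤ X := hNq.trans hq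
  have hNbig : 10 ^ 12 < N := by
    have e1 : N ^ 11 ≤ X ^ 11 := by gcongr
    have e2 : 10 ^ 12 * N ^ 11 < N * N ^ 11 := by
      calc 10 ^ 12 * N ^ 11 ≤ 10 ^ 12 * X ^ 11 := by gcongr
        _ < N ^ 12 := hcon
        _ = N * N ^ 11 := by ring
    exact lt_of_mul_lt_mul_right e2 (by positivity)
  obtain ⟨d, hd⟩ : ∃ d, d = 400 * X ^ 3 / N ^ 2 + 1 := ⟨_, rfl⟩
  have hd1 : 400 * X ^ 3 ≤ d * N ^ 2 := by
    have := Nat.div_add_mod (400 * X ^ 3) (N ^ 2)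
    have h2 := Nat.mod_lt (400 * X ^ 3) (show 0 < N ^ 2 by positivity)
    rw [hd]
    nlinarith
  have hd2 : d * N ^ 2 ≤ 800 * X ^ 3 := by
    have h2 := Nat.div_mul_le_self (400 * X ^ 3) (N ^ 2)
    have h3 : N ^ 2 ≤ X ^ 3 := by
      calc N ^ 2 ≤ N ^ 3 := Nat.pow_le_pow_right hNpos (by norm_num)
        _ ≤ X ^ 3 := by gcongr
    rw [hd, add_mul]
    omega
  have hdN : 400 * N ≤ d := by
    have : N ^ 2 * (400 * N) ≤ N ^ 2 * d := by
      calc N ^ 2 * (400 * N) = 400 * N ^ 3 := by ring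
        _ ≤ 400 * X ^ 3 := by gcongr
        _ ≤ d * N ^ 2 := hd1
        _ = _ := by ring
    exact Nat.le_of_mul_le_mul_left this (by positivity)
  have hX6 : 10 ^ 12 * X ^ 6 ≤ N ^ 7 := by
    have : N ^ 5 * (10 ^ 12 * X ^ 6) ≤ N ^ 5 * N ^ 7 := by
      calc N ^ 5 * (10 ^ 12 * X ^ 6) ≤ X ^ 5 * (10 ^ 12 * X ^ 6) := by gcongr
        _ = 10 ^ 12 * X ^ 11 := by ring
        _ ≤ N ^ 12 := hcon.le
        _ = _ := by ring
    exact Nat.le_of_mul_le_mul_left this (by positivity)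
  have hd3 : d ^ 2 ≤ N ^ 3 := by
    have : N ^ 4 * d ^ 2 ≤ N ^ 4 * N ^ 3 := by
      calc N ^ 4 * d ^ 2 = (d * N ^ 2) ^ 2 := by ring
        _ ≤ (800 * X ^ 3) ^ 2 := by gcongr
        _ = 640000 * X ^ 6 := by ring
        _ ≤ 10 ^ 12 * X ^ 6 := by gcongr; norm_num
        _ ≤ N ^ 7 := hX6
        _ = _ := by ring
    exact Nat.le_of_mul_le_mul_left this (by positivity)
  have hdp : 3 * d ≤ p := by
    refine le_trans ?_ hBp
    have : (3 * d) ^ 2 ≤ (N ^ 2) ^ 2 := by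
      calc (3 * d) ^ 2 = 9 * d ^ 2 := by ring
        _ ≤ 9 * N ^ 3 := by gcongr
        _ ≤ N * N ^ 3 := by gcongr; omega
        _ = _ := by ring
    exact (Nat.pow_le_pow_iff_left (by norm_num)).1 this
  have hMle : d ^ 2 / 4 ≤ B.card ^ 2 * (B * B).card := by
    calc d ^ 2 / 4 ≤ d ^ 2 := Nat.div_le_self _ _
      _ ≤ N ^ 3 := hd3
      _ = N ^ 2 * N := by ring
      _ ≤ B.card ^ 2 * (B * B).card := by rw [← hN]; gcongr
  have hd20 : 20 ≤ d ^ 2 := by nlinarith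
  obtain ⟨T, S, J, k1, k2, k3, k4⟩ := numbers p hp B h0 h1 d (d ^ 2 / 4) (by omega) hdp hMle
  rw [← hN] at k1 k2 k3
  have hM1 : d ^ 2 ≤ 5 * (d ^ 2 / 4) := by omega
  have hM2 : 4 * (d ^ 2 / 4) ≤ d ^ 2 := by omega
  generalize d ^ 2 / 4 = M at *
  apply arith (N : ℝ) X (B * B).card ((B + {1}) * (B + {1})).card d M T S J
  all_goals first
    | exact_mod_cast hNpos
    | exact_mod_cast hNX
    | exact_mod_cast hq
    | exact_mod_cast hw
    | exact_mod_cast hcon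
    | exact_mod_cast hd1
    | exact_mod_cast hd2
    | exact_mod_cast hM1
    | exact_mod_cast hM2
    | exact_mod_cast k1
    | exact_mod_cast k2
    | exact_mod_cast k3
    | exact_mod_cast k4
    | positivity

end MPS

theorem max_product_shifted_bound :
    ∃ c : ℝ, 0 < c ∧ ∀ (p : ℕ), p.Prime → ∀ (A : Finset (ZMod p)),
      (A.card : ℝ) ≤ Real.sqrt p →
      c * (A.card : ℝ) ^ ((1 : ℝ) + 1 / 26) ≤
        max ((A * A).card : ℝ) (((A + {1}) * (A + {1})).card : ℝ) := by
  refine ⟨1 / 1000, by norm_num, ?_⟩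
  intro p hp A hA
  have : Fact p.Prime := ⟨hp⟩
  obtain ⟨X, hX⟩ : ∃ X, X = max (A * A).card ((A + {1}) * (A + {1})).card := ⟨_, rfl⟩
  have hXc : max ((A * A).card : ℝ) (((A + {1}) * (A + {1})).card : ℝ) = (X : ℝ) := by
    rw [hX]; push_cast; rfl
  rw [hXc]
  rcases Nat.eq_zero_or_pos A.card with ha | ha
  · rw [ha]
    rw [Nat.cast_zero, Real.zero_rpow (by norm_num), mul_zero]
    positivity
  have ha1 : (1 : ℝ) ≤ A.card := by exact_mod_cast ha
  have hX1 : 1 ≤ X := by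
    rw [hX]
    refine le_max_of_le_left ?_
    have hne := Finset.card_pos.1 ha
    exact Finset.card_pos.2 (hne.mul hne)
  have hX1' : (1 : ℝ) ≤ X := by exact_mod_cast hX1
  rcases lt_or_ge A.card 4 with h4 | h4
  · have e1 : (A.card : ℝ) ^ ((1 : ℝ) + 1 / 26) ≤ (A.card : ℝ) ^ (2 : ℝ) :=
      Real.rpow_le_rpow_of_exponent_le ha1 (by norm_num)
    rw [Real.rpow_two] at e1
    have e2 : (A.card : ℝ) < 4 := by exact_mod_cast h4
    have e3 : (A.card : ℝ) ^ 2 ≤ 16 := by nlinarith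
    linarith
  · obtain ⟨B, hB⟩ : ∃ B, B = (A.erase 0).erase (-1) := ⟨_, rfl⟩
    have hBA : B ⊆ A := by
      rw [hB]
      exact (Finset.erase_subset _ _).trans (Finset.erase_subset _ _)
    have hBc : A.card ≤ B.card + 2 := by
      have e1 := Finset.pred_card_le_card_erase (s := A) (a := (0 : ZMod p))
      have e2 := Finset.pred_card_le_card_erase (s := A.erase 0) (a := (-1 : ZMod p))
      rw [hB]
      omega
    have hAp : A.card ^ 2 ≤ p := by
      have := (Real.le_sqrt (by positivity) (by positivity)).1 hA
      exact_mod_cast this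
    have hAB : B.card ≤ A.card := Finset.card_le_card hBA
    have key := MPS.power_bound p hp B (by rw [hB]; simp) (by rw [hB]; simp)
      (le_trans (Nat.pow_le_pow_left hAB 2) hAp) X
      ((Finset.card_le_card (Finset.mul_subset_mul hBA hBA)).trans (hX ▸ le_max_left _ _))
      ((Finset.card_le_card (Finset.mul_subset_mul (Finset.add_subset_add_right hBA)
        (Finset.add_subset_add_right hBA))).trans (hX ▸ le_max_right _ _))
    have key' : (B.card : ℝ) ^ 12 ≤ 10 ^ 12 * (X : ℝ) ^ 11 := by exact_mod_cast key
    have hhalf : (A.card : ℝ) ≤ 2 * B.card := by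
      have : A.card ≤ 2 * B.card := by omega
      exact_mod_cast this
    have e0 : (A.card : ℝ) ^ 12 ≤ (2 * B.card) ^ 12 := by gcongr
    have e1 : (A.card : ℝ) ^ ((1 : ℝ) + 1 / 26) ≤ (A.card : ℝ) ^ ((12 : ℝ) / 11) :=
      Real.rpow_le_rpow_of_exponent_le ha1 (by norm_num)
    have e2 : ((A.card : ℝ) ^ ((12 : ℝ) / 11)) ^ 11 = (A.card : ℝ) ^ 12 := by
      rw [← Real.rpow_natCast, ← Real.rpow_mul (by positivity), ← Real.rpow_natCast]
      norm_num
    have e3 : (1 / 1000 * (A.card : ℝ) ^ ((12 : ℝ) / 11)) ^ 11 ≤ (X : ℝ) ^ 11 := by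
      rw [mul_pow, e2]
      have : (0 : ℝ) ≤ (X : ℝ) ^ 11 := by positivity
      rw [mul_pow] at e0
      norm_num at e0 key' ⊢
      linarith
    have e4 := le_of_pow_le_pow_left₀ (by norm_num) (by positivity) e3
    linarith
end

section
/- Let G, H be multiplicative subgroups of 𝔽_p^* with |G|, |H| ≤ √p, and let d ∈ 𝔽_p be nonzero. Then the number of pairs (g, h) ∈ G × H with g − h = d is ≪ max(|G|, |H|)^{26/27}. -/
open Polynomial in
lemma sparse_vanish {p : ℕ} [Fact p.Prime] {ι : Type*} [DecidableEq ι] (d : ZMod p) (hd : d ≠ 0)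
    (e : ι → ℕ) (s : Finset ι) :
    (∀ i ∈ s, e i < p) → Set.InjOn e s → 
    ∀ c : ι → ZMod p, (X + C d) ^ s.card ∣ ∑ i ∈ s, C (c i) * X ^ (e i) → ∀ i ∈ s, c i = 0 := by
  induction s using Finset.induction_on with
  | empty => simp
  | insert a s ha ih =>
    intro hlt hinj c hdvd
    have h1 : ∀ i ∈ s, c i = 0 := by
      have key := ih (fun i hi => hlt i (Finset.mem_insert_of_mem hi))
        (hinj.mono (by simp)) (fun i => ((e i : ZMod p) - e a) * c i) (by
          have hd1 := pow_sub_one_dvd_derivative_of_pow_dvd hdvd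
          rw [Finset.card_insert_of_notMem ha] at hd1 hdvd
          have hd2 : (X + C d) ^ s.card ∣ ∑ i ∈ insert a s, C (c i) * X ^ (e i) :=
            (pow_dvd_pow _ (Nat.le_succ _)).trans hdvd
          simp only [Nat.add_sub_cancel] at hd1
          have h3 := dvd_sub (hd1.mul_left X) (hd2.mul_left (C (e a : ZMod p)))
          convert h3 using 1
          rw [derivative_sum, Finset.mul_sum, Finset.mul_sum, ← Finset.sum_sub_distrib,
            Finset.sum_insert ha]
          have hx : ∀ i, X * derivative (C (c i) * X ^ e i) - C (e a : ZMod p) * (C (c i) * X ^ e i)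
            = C (((e i : ZMod p) - e a) * c i) * X ^ e i := by
            intro i
            rw [derivative_C_mul_X_pow]
            rcases Nat.eq_zero_or_pos (e i) with h | h
            · simp [h]
            · obtain ⟨k, hk⟩ := Nat.exists_eq_succ_of_ne_zero h.ne'
              rw [hk]; simp only [Nat.succ_eq_add_one, Nat.add_sub_cancel, C_mul, C_sub]
              ring
          simp only [hx]
          simp)
      intro i hi
      have := key i hi
      rcases mul_eq_zero.1 this with h | h
      · exfalso
        have h' : (e i : ZMod p) = e a := sub_eq_zero.1 h
        rw [ZMod.natCast_eq_natCast_iff'] at h'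
        rw [Nat.mod_eq_of_lt (hlt i (by simp [hi])), Nat.mod_eq_of_lt (hlt a (by simp))] at h'
        have := hinj (by simp [hi]) (by simp) h'
        exact ha (this ▸ hi)
      · exact h
    intro i hi
    rcases Finset.mem_insert.1 hi with rfl | hi
    · rw [Finset.sum_insert ha, Finset.sum_eq_zero (fun j hj => by simp [h1 j hj])] at hdvd
      rw [Finset.card_insert_of_notMem ha, add_zero] at hdvd
      have h4 : (X + C d) ∣ C (c i) * X ^ e i := (dvd_pow_self _ (Nat.succ_ne_zero _)).trans hdvd
      have h5 : (X - C (-d)) ∣ C (c i) * X ^ e i := by simpa using h4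
      rw [dvd_iff_isRoot] at h5
      simpa [hd] using h5
    · exact h1 i hi

open Polynomial in
noncomputable def Lop {K : Type*} [Field K] (d : K) (a b : ℕ) : K[X] →ₗ[K] K[X] :=
  (LinearMap.mulLeft K (X * (X + C d))) ∘ₗ derivative +
    LinearMap.mulLeft K (C (a : K) * X + C (b : K) * (X + C d))

open Polynomial in
lemma Lop_apply {K : Type*} [Field K] (d : K) (a b : ℕ) (Q : K[X]) :
    Lop d a b Q = X * (X + C d) * derivative Q + (C (a : K) * X + C (b : K) * (X + C d)) * Q := by
  simp [Lop, mul_assoc]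

open Polynomial in
lemma Lop_conj {K : Type*} [Field K] (d : K) (a b : ℕ) (Q : K[X]) :
    Lop d 0 0 ((X + C d) ^ a * X ^ b * Q) = (X + C d) ^ a * X ^ b * Lop d a b Q := by
  simp only [Lop_apply]
  have h1 : (X + C d) * derivative ((X + C d) ^ a) = C (a : K) * (X + C d) ^ a := by
    rw [derivative_X_add_C_pow]
    rcases a with _ | a
    · simp
    · simp only [Nat.add_sub_cancel]; ring
  have h2 : X * derivative (X ^ b : K[X]) = C (b : K) * X ^ b := by
    rw [derivative_X_pow]
    rcases b with _ | a
    · simp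
    · simp only [Nat.add_sub_cancel]; ring
  simp only [derivative_mul, Nat.cast_zero, C_0]
  linear_combination (X * X ^ b * Q) * h1 + ((X + C d) * (X + C d) ^ a * Q) * h2

open Polynomial in
lemma Lop_conj_iter {K : Type*} [Field K] (d : K) (a b r : ℕ) (Q : K[X]) :
    ((Lop d 0 0) ^ r) ((X + C d) ^ a * X ^ b * Q) = (X + C d) ^ a * X ^ b * ((Lop d a b) ^ r) Q := by
  induction r with
  | zero => simp
  | succ r ih => rw [pow_succ', Module.End.mul_apply, ih, Lop_conj, pow_succ', Module.End.mul_apply]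

open Polynomial in
lemma Lop_degree {K : Type*} [Field K] (d : K) (a b n : ℕ) (Q : K[X]) (h : Q.natDegree ≤ n) :
    (Lop d a b Q).natDegree ≤ n + 1 := by
  rw [Lop_apply]
  refine natDegree_add_le_of_degree_le ?_ ?_
  · rcases Nat.eq_zero_or_pos n with h0 | h0
    · have : derivative Q = 0 := by
        rw [eq_C_of_natDegree_le_zero (h.trans h0.le)]; simp
      simp [this]
    · refine (natDegree_mul_le_of_le (m := 2) (n := n - 1) ?_ ?_).trans (by omega)
      · compute_degree
      · exact (natDegree_derivative_le Q).trans (by omega)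
  · rw [add_comm n 1]
    refine natDegree_mul_le_of_le ?_ h
    compute_degree

open Polynomial in
lemma Lop_degree_iter {K : Type*} [Field K] (d : K) (a b n r : ℕ) (Q : K[X])
    (h : Q.natDegree ≤ n) : (((Lop d a b) ^ r) Q).natDegree ≤ n + r := by
  induction r with
  | zero => simpa using h
  | succ r ih =>
    rw [pow_succ', Module.End.mul_apply]
    exact Lop_degree _ _ _ _ _ ih

open Polynomial in
lemma mult_of_Lop {p : ℕ} [Fact p.Prime] (d h : ZMod p) (h0 : h ≠ 0) (h1 : h + d ≠ 0) (D : ℕ) :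
    ∀ F : (ZMod p)[X], D ≤ p → (∀ r < D, (((Lop d 0 0) ^ r) F).eval h = 0) →
    (X - C h) ^ D ∣ F := by
  induction D with
  | zero => simp
  | succ D ih =>
    intro F hD hr
    have hroot : F.IsRoot h := by simpa using hr 0 (by omega)
    have h2 := ih (Lop d 0 0 F) (by omega) (fun r hrD => by
      have := hr (r + 1) (by omega)
      rwa [pow_succ, Module.End.mul_apply] at this)
    rw [Lop_apply] at h2
    simp only [Nat.cast_zero, C_0, zero_mul, add_zero] at h2
    by_cases hF : F = 0
    · simp [hF]
    have hcop : IsCoprime ((X - C h) ^ D) (X * (X + C d)) := by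
      apply IsCoprime.pow_left
      rw [(irreducible_X_sub_C h).coprime_iff_not_dvd, dvd_iff_isRoot]
      simp [h0, h1]
    have h3 := hcop.dvd_of_dvd_mul_left h2
    rw [← le_rootMultiplicity_iff hF]
    by_contra hlt
    push Not at hlt
    have hpos := (rootMultiplicity_pos hF).2 hroot
    have hne : (F.rootMultiplicity h : ZMod p) ≠ 0 := by
      rw [Ne, ZMod.natCast_eq_zero_iff]
      intro hdv
      have := Nat.le_of_dvd hpos hdv
      omega
    have h4 := derivative_rootMultiplicity_of_root_of_mem_nonZeroDivisors hroot
      (mem_nonZeroDivisors_of_ne_zero hne)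
    have hder : derivative F ≠ 0 := by
      intro hz
      obtain ⟨k, hk⟩ : ∃ k, F.rootMultiplicity h = k + 1 := ⟨_, (Nat.succ_pred_eq_of_pos hpos).symm⟩
      obtain ⟨q, hq, hq'⟩ := exists_eq_pow_rootMultiplicity_mul_and_not_dvd F hF h
      rw [hk] at hq hne
      apply hq'
      have : (X - C h) ^ k * (C ((k + 1 : ℕ) : ZMod p) * q + (X - C h) * derivative q) = 0 := by
        rw [← hz]
        conv_rhs => rw [hq]
        rw [derivative_mul, derivative_X_sub_C_pow]
        simp only [Nat.add_sub_cancel]; ring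
      have h5 := (mul_eq_zero.1 this).resolve_left (pow_ne_zero _ (X_sub_C_ne_zero h))
      have h6 : (X - C h) ∣ C ((k + 1 : ℕ) : ZMod p) * q := by
        rw [eq_neg_of_add_eq_zero_left h5]; exact (dvd_mul_right _ _).neg_right
      rw [dvd_iff_isRoot] at h6 ⊢
      simpa [IsRoot, hne, -Nat.cast_add, -Nat.cast_succ] using h6
    rw [← le_rootMultiplicity_iff hder, h4] at h3
    omega

lemma adic_zero {R : Type*} [CommRing R] [IsDomain R] (P : R) (hP : P ≠ 0) (B : ℕ) :
    ∀ f : Fin B → R, (∀ j, P ∣ f j → f j = 0) → ∑ j : Fin B, P ^ (j : ℕ) * f j = 0 → ∀ j, f j = 0 := by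
  induction B with
  | zero => intro f _ _ j; exact j.elim0
  | succ B ih =>
    intro f hf hs
    have hs' : f 0 + P * ∑ j : Fin B, P ^ (j : ℕ) * f j.succ = 0 := by
      rw [← hs, Fin.sum_univ_succ, Finset.mul_sum]
      simp [pow_succ', mul_assoc]
    have h0 : f 0 = 0 := hf 0 (by
      rw [eq_neg_of_add_eq_zero_left hs']; exact (dvd_mul_right _ _).neg_right)
    rw [h0, zero_add] at hs'
    have := ih (fun j => f j.succ) (fun j => hf j.succ) ((mul_eq_zero.1 hs').resolve_left hP)
    intro j
    exact Fin.cases h0 this j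

open Polynomial in
lemma exists_coeffs {K : Type*} [Field K] (d : K) (m n A B D : ℕ)
    (hcard : D * (A + D) < B * B * A) :
    ∃ c : Fin B × Fin B × Fin A → K, c ≠ 0 ∧ ∀ r < D,
      ∑ t, C (c t) * ((Lop d (m * t.1) (n * t.2.1)) ^ r) (X ^ (t.2.2 : ℕ)) = 0 := by
  let φ : (Fin B × Fin B × Fin A → K) →ₗ[K] (Fin D × Fin (A + D) → K) :=
    LinearMap.pi fun rs => ∑ t : Fin B × Fin B × Fin A, (LinearMap.proj t : _ →ₗ[K] K).smulRight
      ((((Lop d (m * t.1) (n * t.2.1)) ^ (rs.1 : ℕ)) (X ^ (t.2.2 : ℕ))).coeff rs.2)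
  have hφ : LinearMap.ker φ ≠ ⊥ := by
    apply LinearMap.ker_ne_bot_of_finrank_lt
    simp only [Module.finrank_fintype_fun_eq_card, Fintype.card_prod, Fintype.card_fin]
    rwa [← mul_assoc]
  obtain ⟨c, hc, hc0⟩ := (Submodule.ne_bot_iff _).1 hφ
  refine ⟨c, hc0, fun r hr => ?_⟩
  ext s
  rw [finsetSum_coeff, coeff_zero]
  simp only [coeff_C_mul]
  by_cases hs : s < A + D
  · have := congrFun (LinearMap.mem_ker.1 hc) (⟨r, hr⟩, ⟨s, hs⟩)
    simpa [φ, LinearMap.sum_apply] using this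
  · refine Finset.sum_eq_zero fun t _ => ?_
    rw [coeff_eq_zero_of_natDegree_lt, mul_zero]
    have := Lop_degree_iter d (m * t.1) (n * t.2.1) t.2.2 r (X ^ (t.2.2 : ℕ)) (by simp)
    have h2 := t.2.2.isLt
    omega

open Polynomial in
lemma stepanov {p : ℕ} [Fact p.Prime] (d : ZMod p) (hd : d ≠ 0) (m n A B D : ℕ)
    (hcard : D * (A + D) < B * B * A) (hD : D ≤ p) (hAB : B * A ≤ m) (hAn : A ≤ n)
    (hp : A + n * B ≤ p) (S : Finset (ZMod p))
    (hS : ∀ h ∈ S, h ≠ 0 ∧ h + d ≠ 0 ∧ h ^ n = 1 ∧ (h + d) ^ m = 1) :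
    S.card * D ≤ m * B + n * B + A := by
  obtain ⟨c, hc0, hc⟩ := exists_coeffs d m n A B D hcard
  set F : (ZMod p)[X] := ∑ t, C (c t) * ((X + C d) ^ (m * (t.1 : ℕ)) * X ^ (n * (t.2.1 : ℕ)) *
    X ^ (t.2.2 : ℕ)) with hFdef
  have hF : F ≠ 0 := by
    intro hF0
    apply hc0
    let f : Fin B → (ZMod p)[X] := fun j => ∑ t : Fin B × Fin A,
      C (c (j, t)) * X ^ (n * (t.1 : ℕ) + t.2)
    have hinj : Set.InjOn (fun t : Fin B × Fin A => n * (t.1 : ℕ) + t.2)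
        (Finset.univ : Finset (Fin B × Fin A)) := by
      rintro ⟨k, i⟩ - ⟨k', i'⟩ - h
      have hi := i.isLt
      have hi' := i'.isLt
      have hn : 0 < n := by omega
      simp only at h
      have e1 := congrArg (· / n) h
      have e2 := congrArg (· % n) h
      simp only [Nat.mul_add_div hn, Nat.div_eq_of_lt (hi.trans_le hAn),
        Nat.div_eq_of_lt (hi'.trans_le hAn), Nat.mul_add_mod, Nat.mod_eq_of_lt (hi.trans_le hAn),
        Nat.mod_eq_of_lt (hi'.trans_le hAn)] at e1 e2
      ext <;> simp <;> omega
    have hcoef : ∀ j, (X + C d) ^ m ∣ f j → ∀ t, c (j, t) = 0 := by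
      intro j hj t
      refine sparse_vanish d hd (fun t : Fin B × Fin A => n * (t.1 : ℕ) + t.2)
        Finset.univ ?_ hinj (fun t => c (j, t)) ?_ t (Finset.mem_univ _)
      · rintro ⟨k, i⟩ -
        have hi := i.isLt
        have : n * (k : ℕ) ≤ n * B := Nat.mul_le_mul_left _ k.isLt.le
        simp only
        omega
      · refine (pow_dvd_pow _ ?_).trans hj
        simpa using hAB
    have hall := adic_zero ((X + C d : (ZMod p)[X]) ^ m) (pow_ne_zero _ (X_add_C_ne_zero d)) B f
      (fun j hj => Finset.sum_eq_zero fun t _ => by simp [hcoef j hj t]) (by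
        rw [← hF0, hFdef, Fintype.sum_prod_type]
        refine Finset.sum_congr rfl fun j _ => ?_
        rw [Finset.mul_sum]
        refine Finset.sum_congr rfl fun t _ => ?_
        rw [← pow_mul, pow_add]; ring)
    ext ⟨j, t⟩
    exact hcoef j (by rw [hall j]; exact dvd_zero _) t
  have hdeg : F.natDegree ≤ m * B + n * B + A := by
    refine natDegree_sum_le_of_forall_le _ _ fun t _ => ?_
    refine (natDegree_C_mul_le _ _).trans ?_
    refine natDegree_mul_le_of_le (natDegree_mul_le_of_le ?_ ?_) ?_
    · refine (natDegree_pow_le_of_le (m * (t.1 : ℕ)) (natDegree_X_add_C d).le).trans ?_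
      rw [mul_one]; exact Nat.mul_le_mul_left _ t.1.isLt.le
    · rw [natDegree_X_pow]; exact Nat.mul_le_mul_left _ t.2.1.isLt.le
    · rw [natDegree_X_pow]; exact t.2.2.isLt.le
  have hdvd : ∏ h ∈ S, (X - C h) ^ D ∣ F := by
    refine Finset.prod_dvd_of_coprime ?_ ?_
    · intro a _ b _ hab
      exact (isCoprime_X_sub_C_of_isUnit_sub (sub_ne_zero.2 hab).isUnit).pow
    · intro h hh
      obtain ⟨h0, h1, h2, h3⟩ := hS h hh
      refine mult_of_Lop d h h0 h1 D F hD fun r hr => ?_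
      have e := congrArg (eval h) (hc r hr)
      rw [eval_finsetSum, eval_zero] at e
      rw [hFdef, map_sum, eval_finsetSum, ← e]
      refine Finset.sum_congr rfl fun t _ => ?_
      rw [← smul_eq_C_mul, map_smul, Lop_conj_iter, ← smul_eq_C_mul]
      simp [pow_mul, h2, h3]
  have := natDegree_le_of_dvd hdvd hF
  rw [natDegree_prod _ _ (fun h _ => pow_ne_zero _ (X_sub_C_ne_zero h))] at this
  simp only [natDegree_pow, natDegree_X_sub_C, mul_one, Finset.sum_const, smul_eq_mul] at this
  exact this.trans hdeg

lemma pow_card_eq_one_of_closed {K : Type*} [Field K] (G : Finset K) (h0 : (0 : K) ∉ G)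
    (hm : ∀ x ∈ G, ∀ y ∈ G, x * y ∈ G) (x : K) (hx : x ∈ G) : x ^ G.card = 1 := by
  classical
  have hx0 : x ≠ 0 := fun h => h0 (h ▸ hx)
  have himg : G.image (fun y => x * y) = G := by
    apply Finset.eq_of_subset_of_card_le
    · intro z hz
      obtain ⟨y, hy, rfl⟩ := Finset.mem_image.1 hz
      exact hm x hx y hy
    · rw [Finset.card_image_of_injective _ (mul_right_injective₀ hx0)]
  have h1 : ∏ y ∈ G, y = x ^ G.card * ∏ y ∈ G, y := by
    conv_lhs => rw [← himg]
    rw [Finset.prod_image (fun a _ b _ h => mul_right_injective₀ hx0 h), Finset.prod_mul_distrib,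
      Finset.prod_const]
  have h2 : ∏ y ∈ G, y ≠ 0 := Finset.prod_ne_zero_iff.2 fun y hy h => h0 (h ▸ hy)
  exact mul_right_cancel₀ h2 (by rw [← h1, one_mul])

/-- For multiplicative subgroups `G, H ≤ 𝔽_p^*` with `|G|, |H| ≤ √p` and `d ≠ 0`,
the number of solutions to `g - h = d` is `≪ max(|G|,|H|)^(26/27)`. -/
theorem subgroup_shifted_intersection_bound :
    ∃ c : ℝ, 0 < c ∧ ∀ (p : ℕ), p.Prime → ∀ (G H : Finset (ZMod p)) (d : ZMod p),
      (0 : ZMod p) ∉ G → (1 : ZMod p) ∈ G → (∀ x ∈ G, ∀ y ∈ G, x * y ∈ G) →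
        (∀ x ∈ G, x⁻¹ ∈ G) →
      (0 : ZMod p) ∉ H → (1 : ZMod p) ∈ H → (∀ x ∈ H, ∀ y ∈ H, x * y ∈ H) →
        (∀ x ∈ H, x⁻¹ ∈ H) →
      (G.card : ℝ) ≤ Real.sqrt p → (H.card : ℝ) ≤ Real.sqrt p → d ≠ 0 →
      ((((G ×ˢ H).filter (fun t => t.1 - t.2 = d)).card : ℝ) ≤
        c * ((max G.card H.card : ℕ) : ℝ) ^ ((26 : ℝ) / 27)) := by
  refine ⟨9, by norm_num, ?_⟩
  intro p hp G H d hG0 hG1 hGm _ hH0 hH1 hHm _ hGp hHp hd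
  have : Fact p.Prime := ⟨hp⟩
  set T := (G ×ˢ H).filter (fun t => t.1 - t.2 = d) with hT
  set m := G.card with hm
  set n := H.card with hn
  set M := max m n with hM
  have hm1 : 1 ≤ m := Finset.card_pos.2 ⟨1, hG1⟩
  have hmM : m ≤ M := le_max_left _ _
  have hnM : n ≤ M := le_max_right _ _
  have hM1 : 1 ≤ M := hm1.trans hmM
  have hMp : M * M ≤ p := by
    have h1 : (M : ℝ) ≤ Real.sqrt p := by
      rw [hM, Nat.cast_max]; exact max_le hGp hHp
    have h2 : (M : ℝ) * M ≤ p := by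
      calc (M : ℝ) * M ≤ Real.sqrt p * Real.sqrt p := by gcongr
        _ = p := Real.mul_self_sqrt (Nat.cast_nonneg _)
    exact_mod_cast h2
  -- the two projections
  have hinj2 : Set.InjOn (fun t : ZMod p × ZMod p => t.2) T := by
    rintro ⟨a, b⟩ h1 ⟨a', b'⟩ h2 h
    simp only [hT, Finset.coe_filter, Finset.mem_product, Set.mem_ofPred_eq] at h1 h2
    simp only at h
    subst h
    have : a = a' := sub_left_injective (h1.2.trans h2.2.symm)
    rw [this]
  have hinj1 : Set.InjOn (fun t : ZMod p × ZMod p => t.1) T := by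
    rintro ⟨a, b⟩ h1 ⟨a', b'⟩ h2 h
    simp only [hT, Finset.coe_filter, Finset.mem_product, Set.mem_ofPred_eq] at h1 h2
    simp only at h
    subst h
    have : b = b' := sub_right_injective (h1.2.trans h2.2.symm)
    rw [this]
  have hTm : T.card ≤ m := Finset.card_le_card_of_injOn _ (fun t ht => by
    simp only [hT, Finset.coe_filter, Finset.mem_product, Set.mem_ofPred_eq] at ht
    exact ht.1.1) hinj1
  have hTn : T.card ≤ n := Finset.card_le_card_of_injOn _ (fun t ht => by
    simp only [hT, Finset.coe_filter, Finset.mem_product, Set.mem_ofPred_eq] at ht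
    exact ht.1.2) hinj2
  -- real quantities
  have hMr : (1 : ℝ) ≤ M := by exact_mod_cast hM1
  set t : ℝ := (M : ℝ) ^ ((1 : ℝ) / 27) with ht
  have ht1 : 1 ≤ t := Real.one_le_rpow hMr (by norm_num)
  have ht27 : t ^ 27 = M := by
    rw [ht, ← Real.rpow_natCast, ← Real.rpow_mul (by positivity)]; norm_num
  have ht26 : (M : ℝ) ^ ((26 : ℝ) / 27) = t ^ 26 := by
    rw [ht, ← Real.rpow_natCast, ← Real.rpow_mul (by positivity)]; norm_num
  rw [ht26]
  have ht26p : 1 ≤ t ^ 26 := one_le_pow₀ ht1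
  by_cases hmb : (m : ℝ) < t ^ 26
  · have : (T.card : ℝ) ≤ m := by exact_mod_cast hTm
    linarith
  by_cases hnb : (n : ℝ) < t ^ 26
  · have : (T.card : ℝ) ≤ n := by exact_mod_cast hTn
    linarith
  push Not at hmb hnb
  set b := ⌊t⌋₊ with hb
  have hbt : (b : ℝ) ≤ t := Nat.floor_le (by linarith)
  have htb : t < b + 1 := Nat.lt_floor_add_one t
  have hb1 : 1 ≤ b := Nat.le_floor (by simpa using ht1)
  rcases hb1.eq_or_lt with hb1 | hb2
  · have h2 : t < 2 := by rw [← hb1] at htb; norm_num at htb; exact htb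
    have h3 : (T.card : ℝ) ≤ M := by exact_mod_cast hTm.trans hmM
    rw [← ht27] at h3
    have : t ^ 27 = t * t ^ 26 := by ring
    nlinarith
  · have hbm : b ^ 26 ≤ m := by
      have : (b : ℝ) ^ 26 ≤ m := (pow_le_pow_left₀ (by positivity) hbt 26).trans hmb
      exact_mod_cast this
    have hbn : b ^ 26 ≤ n := by
      have : (b : ℝ) ^ 26 ≤ n := (pow_le_pow_left₀ (by positivity) hbt 26).trans hnb
      exact_mod_cast this
    have hb0 : 0 < b := by omega
    have hb4 : 2 * b ^ 3 ≤ b ^ 4 := by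
      have : b ^ 4 = b * b ^ 3 := by ring
      rw [this]; exact Nat.mul_le_mul_right _ hb2
    have hb4m : b ^ 4 ≤ b ^ 26 := Nat.pow_le_pow_right hb0 (by norm_num)
    have hb2m : b ^ 2 ≤ b ^ 26 := Nat.pow_le_pow_right hb0 (by norm_num)
    have hb2M : b ^ 4 ≤ M := hb4m.trans (hbm.trans hmM)
    have h3b : 3 * b ≤ M := by
      have : 2 ^ 3 ≤ b ^ 3 := Nat.pow_le_pow_left hb2 3
      have h' : b ^ 4 = b ^ 3 * b := by ring
      nlinarith
    have hcount := stepanov d hd m n (b ^ 2) (2 * b) (b ^ 2) (by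
        have : 0 < b ^ 4 := by positivity
        have e1 : b ^ 2 * (b ^ 2 + b ^ 2) = 2 * b ^ 4 := by ring
        have e2 : 2 * b * (2 * b) * b ^ 2 = 4 * b ^ 4 := by ring
        omega) (by nlinarith) (by
        have e1 : 2 * b * b ^ 2 = 2 * b ^ 3 := by ring
        omega) (by omega) (by
        have h1 : b ^ 2 ≤ b * M := by nlinarith
        have h2 : n * (2 * b) ≤ 2 * (b * M) := by nlinarith
        nlinarith) (T.image (fun t => t.2)) (by
        intro h hh
        obtain ⟨⟨g, h'⟩, hgh, rfl⟩ := Finset.mem_image.1 hh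
        simp only [hT, Finset.mem_filter, Finset.mem_product] at hgh
        obtain ⟨⟨hg, hh'⟩, he⟩ := hgh
        have he' : h' + d = g := by rw [← he]; ring
        refine ⟨fun e => hH0 (e ▸ hh'), ?_, pow_card_eq_one_of_closed H hH0 hHm h' hh', ?_⟩
        · simp only [he']; exact fun e => hG0 (e ▸ hg)
        · simp only [he']; exact pow_card_eq_one_of_closed G hG0 hGm g hg)
    rw [Finset.card_image_of_injOn hinj2] at hcount
    have hc2 : T.card * b ≤ 4 * M + b := by
      have : (T.card * b) * b ≤ (4 * M + b) * b := by nlinarith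
      exact Nat.le_of_mul_le_mul_right this hb0
    have hc3 : (T.card : ℝ) * b ≤ 4 * M + b := by exact_mod_cast hc2
    have hbr : (1 : ℝ) ≤ b := Nat.one_le_cast.2 hb0
    have h2b : t ≤ 2 * b := by linarith
    have e27 : (M : ℝ) = t * t ^ 26 := by rw [← ht27]; ring
    have h5 : (T.card : ℝ) * b ≤ (9 * t ^ 26) * b := by
      have : t * t ^ 26 ≤ 2 * b * t ^ 26 :=
        mul_le_mul_of_nonneg_right h2b (by linarith)
      nlinarith
    exact le_of_mul_le_mul_right h5 (by linarith)
end

section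
/- Let A, B, C be finite subsets of 𝔽_p^* with |A| = |B| = |C|, let d ∈ 𝔽_p be nonzero, and write |A·B| = K|A|, |(A+d)·C| = L|A|. Then the additive energy satisfies E(A·B, A·B) ≫ L^{−6} K^{−1} |A|³. -/
open Pointwise

/-- The additive energy `E(X,Y)`. -/
def addEnergy {G : Type*} [AddCommGroup G] [DecidableEq G] (X Y : Finset G) : ℕ :=
  ((X ×ˢ Y ×ˢ X ×ˢ Y).filter fun t => t.1 + t.2.1 = t.2.2.1 + t.2.2.2).card

/-- Number of collisions of a pair of functions, as a sum over the fibres. -/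
lemma card_collisions {α β γ : Type*} [DecidableEq γ] (S : Finset α) (S' : Finset β)
    (T : Finset γ) (f : α → γ) (g : β → γ) (hf : ∀ s ∈ S, f s ∈ T) :
    ((S ×ˢ S').filter fun u => f u.1 = g u.2).card =
      ∑ t ∈ T, (S.filter fun s => f s = t).card * (S'.filter fun s => g s = t).card := by
  rw [Finset.card_eq_sum_card_fiberwise (f := fun u => f u.1) (t := T)]
  · refine Finset.sum_congr rfl fun t _ => ?_
    rw [← Finset.card_product]
    congr 1
    ext ⟨a, b⟩
    simp only [Finset.mem_filter, Finset.mem_product]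
    constructor
    · rintro ⟨⟨⟨h1, h2⟩, h3⟩, h4⟩
      exact ⟨⟨h1, h4⟩, h2, h3 ▸ h4⟩
    · rintro ⟨⟨h1, h4⟩, h2, h3⟩
      exact ⟨⟨⟨h1, h2⟩, h4.trans h3.symm⟩, h4⟩
  · intro u hu
    have := (Finset.mem_filter.1 (Finset.mem_coe.1 hu)).1
    exact hf _ (Finset.mem_product.1 this).1

/-- Cauchy–Schwarz for collisions. -/
lemma sq_card_le_collisions {α γ : Type*} [DecidableEq γ] (S : Finset α) (T : Finset γ)
    (f : α → γ) (hf : ∀ s ∈ S, f s ∈ T) :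
    S.card ^ 2 ≤ T.card * ((S ×ˢ S).filter fun u => f u.1 = f u.2).card := by
  rw [card_collisions S S T f f hf, Finset.card_eq_sum_card_fiberwise (f := f) (t := T) hf]
  simp_rw [← sq]
  exact sq_sum_le_card_mul_sum_sq

/-- `E(X, lX) ≤ E(X, X)`. -/
lemma dilate_le_energy {F : Type*} [Field F] [Fintype F] [DecidableEq F] (X : Finset F)
    (l : F) (hl : l ≠ 0) :
    (((X ×ˢ X) ×ˢ (X ×ˢ X)).filter fun u => u.1.1 - u.1.2 = l * (u.2.1 - u.2.2)).card
      ≤ addEnergy X X := by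
  have hE : addEnergy X X =
      (((X ×ˢ X) ×ˢ (X ×ˢ X)).filter fun u => u.1.1 - u.1.2 = (u.2.1 - u.2.2)).card := by
    unfold addEnergy
    refine Finset.card_bij' (fun t _ => ((t.1, t.2.2.1), (t.2.2.2, t.2.1)))
      (fun u _ => (u.1.1, u.2.2, u.1.2, u.2.1)) ?_ ?_ ?_ ?_
    · rintro ⟨a, b, c, e⟩ h
      simp only [Finset.mem_filter, Finset.mem_product] at h ⊢
      refine ⟨by tauto, ?_⟩
      linear_combination h.2
    · rintro ⟨⟨a, b⟩, c, e⟩ h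
      simp only [Finset.mem_filter, Finset.mem_product] at h ⊢
      refine ⟨by tauto, ?_⟩
      linear_combination h.2
    · intros; rfl
    · intros; rfl
  rw [hE, card_collisions (X ×ˢ X) (X ×ˢ X) Finset.univ (fun u => u.1 - u.2)
      (fun u => l * (u.1 - u.2)) (by simp),
    card_collisions (X ×ˢ X) (X ×ˢ X) Finset.univ (fun u => u.1 - u.2)
      (fun u => (u.1 - u.2)) (by simp)]
  set r : F → ℕ := fun t => ((X ×ˢ X).filter fun u => u.1 - u.2 = t).card with hr
  have h2 : ∀ t, ((X ×ˢ X).filter fun u => l * (u.1 - u.2) = t).card = r (l⁻¹ * t) := by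
    intro t
    simp only [hr]
    congr 1
    ext u
    simp only [Finset.mem_filter]
    rw [eq_inv_mul_iff_mul_eq₀ hl]
  simp_rw [h2]
  change ∑ t, r t * r (l⁻¹ * t) ≤ ∑ t, r t * r t
  have h3 : ∑ t, r (l⁻¹ * t) * r (l⁻¹ * t) = ∑ t, r t * r t :=
    Equiv.sum_comp (Equiv.mulLeft₀ l⁻¹ (inv_ne_zero hl)) (fun t => r t * r t)
  have h4 : ∑ t, 2 * (r t * r (l⁻¹ * t)) ≤ ∑ t, (r t * r t + r (l⁻¹ * t) * r (l⁻¹ * t)) := by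
    refine Finset.sum_le_sum fun t _ => ?_
    nlinarith [two_mul_le_add_sq (r t) (r (l⁻¹ * t))]
  rw [← Finset.mul_sum, Finset.sum_add_distrib, h3] at h4
  omega

lemma sq_card_le_energy {F : Type*} [AddCommGroup F] [DecidableEq F] (X : Finset F) :
    X.card ^ 2 ≤ addEnergy X X := by
  rw [sq, ← Finset.card_product]
  unfold addEnergy
  refine Finset.card_le_card_of_injOn (fun u => (u.1, u.2, u.1, u.2)) ?_ ?_
  · rintro ⟨a, b⟩ h
    simp only [Finset.coe_product, Set.mem_prod, Finset.mem_coe] at h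
    simp [h]
  · rintro ⟨a, b⟩ _ ⟨a', b'⟩ _ h
    simp at h
    simp [h]

/-- A popular nontrivial ratio. -/
lemma exists_popular {F : Type*} [Field F] [DecidableEq F] (H C : Finset F) (R : ℕ)
    (hC : (0 : F) ∉ C)
    (hR : ∀ q : F, q ≠ 0 → q ≠ 1 → (H.filter fun h => h * q ∈ H).card ≤ R) :
    (H.card * C.card) ^ 2 ≤ (H * C).card * (C.card * H.card + C.card ^ 2 * R) := by
  have h1 := sq_card_le_collisions (H ×ˢ C) (H * C) (fun u => u.1 * u.2)
    (fun s hs => Finset.mul_mem_mul (Finset.mem_product.1 hs).1 (Finset.mem_product.1 hs).2)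
  rw [Finset.card_product] at h1
  refine h1.trans (Nat.mul_le_mul_left _ ?_)
  rw [Finset.card_eq_sum_card_fiberwise (f := fun u => (u.1.2, u.2.2)) (t := C ×ˢ C)]
  · have h2 : ∀ w ∈ C ×ˢ C, ((((H ×ˢ C) ×ˢ (H ×ˢ C)).filter
        fun u => u.1.1 * u.1.2 = u.2.1 * u.2.2).filter fun u => (u.1.2, u.2.2) = w).card ≤
        (if w.1 = w.2 then H.card else 0) + R := by
      rintro ⟨c, c'⟩ hw
      obtain ⟨hc, hc'⟩ := Finset.mem_product.1 hw
      have c0 : c ≠ 0 := fun h => hC (h ▸ hc)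
      have c0' : c' ≠ 0 := fun h => hC (h ▸ hc')
      have h3 : ((((H ×ˢ C) ×ˢ (H ×ˢ C)).filter
        fun u => u.1.1 * u.1.2 = u.2.1 * u.2.2).filter fun u => (u.1.2, u.2.2) = (c, c')).card ≤
          (H.filter fun h => h * (c / c') ∈ H).card := by
        refine Finset.card_le_card_of_injOn (fun u => u.1.1) ?_ ?_
        · rintro ⟨⟨h, e⟩, h', e'⟩ hu
          simp only [Finset.mem_coe, Finset.mem_filter, Finset.mem_product, Prod.mk.injEq] at hu ⊢
          obtain ⟨⟨⟨⟨g1, g2⟩, g3, g4⟩, g5⟩, rfl, rfl⟩ := hu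
          refine ⟨g1, ?_⟩
          rwa [← mul_div_assoc, g5, mul_div_cancel_right₀ _ c0']
        · rintro ⟨⟨h, e⟩, h', e'⟩ hu ⟨⟨k, f⟩, k', f'⟩ hv hk
          simp only [Finset.mem_coe, Finset.mem_filter, Finset.mem_product, Prod.mk.injEq]
            at hu hv hk ⊢
          obtain ⟨⟨-, g5⟩, rfl, rfl⟩ := hu
          obtain ⟨⟨-, g6⟩, rfl, rfl⟩ := hv
          subst hk
          exact ⟨⟨rfl, rfl⟩, mul_right_cancel₀ c0' (g5.symm.trans g6), rfl⟩
      refine h3.trans ?_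
      dsimp only
      split_ifs with h
      · exact (Finset.card_filter_le _ _).trans (Nat.le_add_right _ _)
      · rw [zero_add]
        refine hR _ (div_ne_zero c0 c0') ?_
        rwa [Ne, div_eq_one_iff_eq c0']
    refine (Finset.sum_le_sum h2).trans ?_
    rw [Finset.sum_add_distrib, Finset.sum_const, Finset.card_product, Finset.sum_product]
    simp [sq]
  · intro u hu
    have := (Finset.mem_filter.1 (Finset.mem_coe.1 hu)).1
    simp only [Finset.mem_product] at this
    simp only [Finset.coe_product, Set.mem_prod, Finset.mem_coe]
    tauto

/-- Lower bound for the energy in terms of a popular ratio. -/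
lemma energy_of_popular {F : Type*} [Field F] [Fintype F] [DecidableEq F] (A B : Finset F)
    (d q a : F) (hA : (0 : F) ∉ A) (ha : a ∈ A) (hd : d ≠ 0)
    (hB : (0 : F) ∉ B) (hq0 : q ≠ 0) (hq1 : q ≠ 1) :
    (((A + {d}).filter fun h => h * q ∈ A + {d}).card * B.card) ^ 2 ≤
      (A * B).card * addEnergy (A * B) (A * B) := by
  have a0 : a ≠ 0 := fun h => hA (h ▸ ha)
  have hmem : ∀ h ∈ A + {d}, h - d ∈ A := by
    intro h hh
    rw [Finset.mem_add] at hh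
    obtain ⟨y, hy, z, hz, rfl⟩ := hh
    rw [Finset.mem_singleton] at hz
    subst hz
    simpa using hy
  set P := (A + {d}).filter fun h => h * q ∈ A + {d} with hP
  have h1 := sq_card_le_collisions (P ×ˢ B) (A * B) (fun u => (u.1 - d) * u.2) (by
    rintro ⟨h, b⟩ hs
    simp only [hP, Finset.mem_product, Finset.mem_filter] at hs
    exact Finset.mul_mem_mul (hmem _ hs.1.1) hs.2)
  rw [Finset.card_product] at h1
  refine h1.trans (Nat.mul_le_mul_left _ ?_)
  have l0 : d * (1 - q) / a ≠ 0 :=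
    div_ne_zero (mul_ne_zero hd (sub_ne_zero.2 hq1.symm)) a0
  refine le_trans ?_ (dilate_le_energy (A * B) _ l0)
  refine Finset.card_le_card_of_injOn
    (fun u => (((u.1.1 * q - d) * u.1.2, (u.2.1 * q - d) * u.2.2), (a * u.2.2, a * u.1.2))) ?_ ?_
  · rintro ⟨⟨h, b⟩, h', b'⟩ hu
    simp only [hP, Finset.mem_coe, Finset.mem_filter, Finset.mem_product] at hu ⊢
    obtain ⟨⟨⟨⟨g1, g2⟩, g3⟩, ⟨g4, g5⟩, g6⟩, g7⟩ := hu
    refine ⟨⟨⟨Finset.mul_mem_mul (hmem _ g2) g3, Finset.mul_mem_mul (hmem _ g5) g6⟩,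
      Finset.mul_mem_mul ha g6, Finset.mul_mem_mul ha g3⟩, ?_⟩
    field_simp
    linear_combination q * g7
  · rintro ⟨⟨h, b⟩, h', b'⟩ hu ⟨⟨k, e⟩, k', e'⟩ hv hk
    simp only [Finset.mem_coe, Finset.mem_filter, Finset.mem_product, Prod.mk.injEq] at hu hv hk ⊢
    obtain ⟨⟨⟨-, g3⟩, -, g6⟩, -⟩ := hu
    obtain ⟨⟨k1, k2⟩, k3, k4⟩ := hk
    have e1 := mul_left_cancel₀ a0 k3
    have e2 := mul_left_cancel₀ a0 k4
    subst e1 e2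
    have b0 : b ≠ 0 := fun h => hB (h ▸ g3)
    have b0' : b' ≠ 0 := fun h => hB (h ▸ g6)
    have f1 := mul_right_cancel₀ hq0 (sub_left_injective (mul_right_cancel₀ b0 k1))
    have f2 := mul_right_cancel₀ hq0 (sub_left_injective (mul_right_cancel₀ b0' k2))
    exact ⟨⟨f1, rfl⟩, f2, rfl⟩

/-- Lower bound for the additive energy of the product set:
if `|A·B| = K|A|` and `|(A+d)·C| = L|A|` then `E(A·B, A·B) ≫ L⁻⁶K⁻¹|A|³`. -/
theorem energy_lower_bound :
    ∃ c : ℝ, 0 < c ∧ ∀ (p : ℕ), p.Prime →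
      ∀ (A B C : Finset (ZMod p)) (d : ZMod p) (K L : ℝ),
      (0 : ZMod p) ∉ A → (0 : ZMod p) ∉ B → (0 : ZMod p) ∉ C → A.Nonempty →
      A.card = B.card → A.card = C.card → d ≠ 0 →
      ((A * B).card : ℝ) = K * A.card → (((A + {d}) * C).card : ℝ) = L * A.card →
      c * L ^ (-(6 : ℝ)) * K ^ (-(1 : ℝ)) * (A.card : ℝ) ^ 3 ≤
        (addEnergy (A * B) (A * B) : ℝ) := by
  refine ⟨1 / 4, by norm_num, ?_⟩
  intro p hp A B C d K L hA hB hC hne hAB hAC hd hK hL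
  have : Fact p.Prime := ⟨hp⟩
  obtain ⟨a, ha⟩ := hne
  have hHcard : (A + {d}).card = A.card := by
    rw [Finset.add_singleton]
    exact Finset.card_image_of_injective _ (add_left_injective d)
  set H := A + {d} with hH
  have npos : 0 < A.card := Finset.card_pos.2 ⟨a, ha⟩
  obtain ⟨b, hb⟩ : B.Nonempty := Finset.card_pos.1 (hAB ▸ npos)
  obtain ⟨c, hc⟩ : C.Nonempty := Finset.card_pos.1 (hAC ▸ npos)
  have b0 : b ≠ 0 := fun h => hB (h ▸ hb)
  have c0 : c ≠ 0 := fun h => hC (h ▸ hc)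
  have hAle : A.card ≤ (A * B).card :=
    Finset.card_le_card_of_injOn (fun x => x * b) (fun x hx => Finset.mul_mem_mul hx hb)
      (fun x _ y _ h => mul_right_cancel₀ b0 h)
  have hHle : A.card ≤ (H * C).card := by
    rw [← hHcard]
    exact Finset.card_le_card_of_injOn (fun x => x * c) (fun x hx => Finset.mul_mem_mul hx hc)
      (fun x _ y _ h => mul_right_cancel₀ c0 h)
  have hE1 : A.card ^ 2 ≤ addEnergy (A * B) (A * B) :=
    (Nat.pow_le_pow_left hAle 2).trans (sq_card_le_energy _)
  -- pass to the reals
  have hE2 : ∀ q : ZMod p, q ≠ 0 → q ≠ 1 →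
      (((H.filter fun h => h * q ∈ H).card : ℝ) * A.card) ^ 2 ≤
      (K * A.card) * (addEnergy (A * B) (A * B) : ℝ) := by
    intro q hq0 hq1
    rw [← hK]
    have := energy_of_popular A B d q a hA ha hd hB hq0 hq1
    rw [← hAB] at this
    exact_mod_cast this
  have hpop : ∃ q : ZMod p, A.card < 2 * L ∨ (q ≠ 0 ∧ q ≠ 1 ∧
      (A.card : ℝ) ≤ 2 * L * ((H.filter fun h => h * q ∈ H).card : ℝ)) := by
    by_contra! hcon
    have hL2 : 2 * L ≤ A.card := (hcon 0).1
    have hn : (0 : ℝ) < A.card := by exact_mod_cast npos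
    have hLpos : 0 < L := by
      have h1 : (A.card : ℝ) ≤ (H * C).card := by exact_mod_cast hHle
      rw [hL] at h1
      nlinarith
    set M := (Finset.univ.filter fun q : ZMod p => q ≠ 0 ∧ q ≠ 1).sup
      (fun q => (H.filter fun h => h * q ∈ H).card) with hM
    have hR : ∀ q : ZMod p, q ≠ 0 → q ≠ 1 → (H.filter fun h => h * q ∈ H).card ≤ M := by
      intro q h0 h1
      exact Finset.le_sup (f := fun q => (H.filter fun h => h * q ∈ H).card)
        (Finset.mem_filter.2 ⟨Finset.mem_univ q, h0, h1⟩)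
    have hM2 : 2 * L * M < A.card := by
      rcases Nat.eq_zero_or_pos M with h0 | h0
      · rw [h0]; simpa using hn
      · have hlt : ∀ q ∈ (Finset.univ.filter fun q : ZMod p => q ≠ 0 ∧ q ≠ 1),
            2 * L * ((H.filter fun h => h * q ∈ H).card : ℝ) < A.card := fun q hq =>
          (hcon q).2 (Finset.mem_filter.1 hq).2.1 (Finset.mem_filter.1 hq).2.2
        have hne : (Finset.univ.filter fun q : ZMod p => q ≠ 0 ∧ q ≠ 1).Nonempty := by
          by_contra h
          rw [Finset.not_nonempty_iff_eq_empty] at h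
          rw [hM, h] at h0
          simp at h0
        obtain ⟨q, hq, hqM⟩ := Finset.exists_mem_eq_sup _ hne
          (fun q => (H.filter fun h => h * q ∈ H).card)
        rw [hM, hqM]
        exact hlt q hq
    have h3 := exists_popular H C M hC hR
    rw [hHcard, ← hAC] at h3
    have h4 : ((A.card : ℝ) * A.card) ^ 2 ≤
        (L * A.card) * ((A.card : ℝ) * A.card + (A.card : ℝ) ^ 2 * M) := by
      rw [← hL]; exact_mod_cast h3
    have h5 : (A.card : ℝ) ^ 3 * A.card ≤ (A.card : ℝ) ^ 3 * (L + L * M) := by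
      linarith [h4]
    have h6 := le_of_mul_le_mul_left h5 (by positivity)
    linarith
  have hn : (0 : ℝ) < A.card := by exact_mod_cast npos
  have hK1 : 1 ≤ K := by
    have : (A.card : ℝ) ≤ (A * B).card := by exact_mod_cast hAle
    rw [hK] at this
    nlinarith
  have hL1 : 1 ≤ L := by
    have : (A.card : ℝ) ≤ (H * C).card := by exact_mod_cast hHle
    rw [hL] at this
    nlinarith
  have hE1' : (A.card : ℝ) ^ 2 ≤ addEnergy (A * B) (A * B) := by exact_mod_cast hE1
  generalize (addEnergy (A * B) (A * B) : ℝ) = E at *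
  have hL0 : 0 < L := by linarith
  have hK0 : 0 < K := by linarith
  rw [Real.rpow_neg hL0.le, Real.rpow_neg hK0.le, Real.rpow_one,
    show (6 : ℝ) = ((6 : ℕ) : ℝ) by norm_num, Real.rpow_natCast]
  generalize (A.card : ℝ) = n at *
  have key : n ^ 3 ≤ 4 * L ^ 2 * K * E := by
    obtain ⟨q, h | ⟨hq0, hq1, hq⟩⟩ := hpop
    · have h1 : n ^ 3 ≤ 2 * L * E := by
        calc n ^ 3 = n * n ^ 2 := by ring
          _ ≤ 2 * L * E := by gcongr
      have hE0 : 0 ≤ E := le_trans (by positivity) hE1'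
      calc n ^ 3 ≤ 2 * L * E := h1
        _ ≤ (4 * L ^ 2 * K) * E := by
            refine mul_le_mul_of_nonneg_right ?_ hE0
            have h5 : 1 ≤ L * K := one_le_mul_of_one_le_of_one_le hL1 hK1
            have h6 : L * 1 ≤ L * (L * K) := mul_le_mul_of_nonneg_left h5 hL0.le
            linarith
    · have h1 := hE2 q hq0 hq1
      generalize ((H.filter fun h => h * q ∈ H).card : ℝ) = R at *
      have h2 : n * n ^ 3 ≤ n * (4 * L ^ 2 * K * E) := by
        calc n * n ^ 3 = n ^ 2 * n ^ 2 := by ring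
          _ ≤ (2 * L * R) ^ 2 * n ^ 2 := by gcongr
          _ = 4 * L ^ 2 * (R * n) ^ 2 := by ring
          _ ≤ 4 * L ^ 2 * (K * n * E) := by gcongr
          _ = n * (4 * L ^ 2 * K * E) := by ring
      exact le_of_mul_le_mul_left h2 hn
  have hE0 : 0 ≤ E := le_trans (by positivity) hE1'
  have key2 : n ^ 3 ≤ 4 * L ^ 6 * K * E := by
    refine key.trans ?_
    gcongr
    norm_num
  calc 1 / 4 * (L ^ 6)⁻¹ * K⁻¹ * n ^ 3 ≤ 1 / 4 * (L ^ 6)⁻¹ * K⁻¹ * (4 * L ^ 6 * K * E) := by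
        gcongr
    _ = E := by field_simp
end
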